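/- Let α > 0 be a real number. Then as x → ∞, Σ_{x^{1/3} < p₃ ≤ x^{1/3}(log x)^{4/α}, p₃ prime} p₃^{-α} Σ_{√(x/p₃) < p₂ < p₃, p₂ prime} Σ_{p₁ ≤ x/(p₂p₃), p₁ prime} p₁^{α} = (9/(α²(α+1)))·x/(log x)^3 + O(x/(log x)^4). -/

import Mathlib

section

open MeasureTheory FourierTransform SchwartzMap ComplexInnerProductSpace

theorem eLpNorm_le_eLpNorm_fourier {f : ℝ → ℂ} (h1 : Integrable f) (h2 : MemLp f 2)
    (hg : MemLp (𝓕 f) 2) : eLpNorm f 2 ≤ eLpNorm (𝓕 f) 2 := by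
  have key : ∀ φ : 𝓢(ℝ, ℂ), ‖⟪φ.toLp 2, h2.toLp f⟫‖ ≤ ‖φ.toLp 2‖ * ‖hg.toLp (𝓕 f)‖ := by
    intro φ
    have e : ⟪φ.toLp 2, h2.toLp f⟫ = ⟪(𝓕 φ).toLp 2, hg.toLp (𝓕 f)⟫ := by
      rw [L2.inner_def, L2.inner_def]
      have e1 : ∫ a, ⟪(φ.toLp 2 : ℝ → ℂ) a, (h2.toLp f : ℝ → ℂ) a⟫ = ∫ a, (innerSL ℂ (φ a)) (f a) := by
        apply integral_congr_ae
        filter_upwards [φ.coeFn_toLp 2, h2.coeFn_toLp] with a ha hb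
        rw [ha, hb]; rfl
      have e2 : ∫ a, ⟪((𝓕 φ).toLp 2 : ℝ → ℂ) a, (hg.toLp (𝓕 f) : ℝ → ℂ) a⟫
          = ∫ a, (innerSL ℂ (𝓕 φ a)) (𝓕 f a) := by
        apply integral_congr_ae
        filter_upwards [(𝓕 φ).coeFn_toLp 2, hg.coeFn_toLp] with a ha hb
        rw [ha, hb]; rfl
      rw [e1, e2]
      have e3 := VectorFourier.integral_sesq_fourierIntegral_eq_neg_flip (innerSL ℂ (E := ℂ))
        (L := -innerₗ ℝ) (e := Real.fourierChar) (μ := volume) (ν := volume)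
        Real.continuous_fourierChar (by simp only [LinearMap.neg_apply, innerₗ_apply_apply]; fun_prop) (𝓕 φ).integrable h1
      have e4 : VectorFourier.fourierIntegral Real.fourierChar volume (-innerₗ ℝ) (⇑(𝓕 φ : 𝓢(ℝ, ℂ))) = φ := by
        have : VectorFourier.fourierIntegral Real.fourierChar volume (-innerₗ ℝ) (⇑(𝓕 φ : 𝓢(ℝ, ℂ)))
            = (𝓕⁻ (⇑(𝓕 φ : 𝓢(ℝ, ℂ)))) := by
          ext w
          simp [VectorFourier.fourierIntegral, Real.fourierInv_eq]
        rw [this, ← SchwartzMap.fourierInv_coe, FourierTransform.fourierInv_fourier_eq]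
      have e5 : VectorFourier.fourierIntegral Real.fourierChar volume (-(-innerₗ ℝ : ℝ →ₗ[ℝ] ℝ →ₗ[ℝ] ℝ).flip) f = 𝓕 f := by
        ext w
        simp [VectorFourier.fourierIntegral, Real.fourier_eq, mul_comm]
      rw [e4, e5] at e3
      exact e3
    rw [e]
    refine (norm_inner_le_norm _ _).trans ?_
    rw [norm_fourier_toL2_eq]
  have key2 : ∀ x : Lp (α := ℝ) ℂ 2, ‖⟪x, h2.toLp f⟫‖ ≤ ‖x‖ * ‖hg.toLp (𝓕 f)‖ := by
    intro x
    refine DenseRange.induction_on (p := fun x : Lp (α := ℝ) ℂ 2 ↦ ‖⟪x, h2.toLp f⟫‖ ≤ ‖x‖ * ‖hg.toLp (𝓕 f)‖) (SchwartzMap.denseRange_toLpCLM (E := ℝ) (F := ℂ) (p := 2) (μ := volume) ENNReal.ofNat_ne_top) x ?_ ?_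
    · exact isClosed_le (by fun_prop) (by fun_prop)
    · intro φ
      exact key φ
  have h3 := key2 (h2.toLp f)
  rw [inner_self_eq_norm_sq_to_K] at h3
  have h4 : ‖h2.toLp f‖ ≤ ‖hg.toLp (𝓕 f)‖ := by
    rcases eq_or_ne ‖h2.toLp f‖ 0 with h | h
    · rw [h]; positivity
    · have : 0 < ‖h2.toLp f‖ := by positivity
      have h5 : ‖h2.toLp f‖ ^ 2 ≤ ‖h2.toLp f‖ * ‖hg.toLp (𝓕 f)‖ := by simpa only [norm_pow, RCLike.norm_ofReal, abs_norm] using h3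
      nlinarith
  rw [Lp.norm_toLp, Lp.norm_toLp] at h4
  exact (ENNReal.toReal_le_toReal h2.2.ne hg.2.ne).1 h4

end

section

open MeasureTheory Filter Asymptotics Complex Topology

/-- The Mellin-type integral `∫_N^∞ {t} t^{-s-1} dt`. -/
noncomputable def fractTail (N : ℕ) (s : ℂ) : ℂ :=
  mellin ((Set.Ioi (N : ℝ)).indicator fun t ↦ ((Int.fract t : ℝ) : ℂ)) (-s)

lemma fractTail_eq {N : ℕ} (s : ℂ) :
    fractTail N s = ∫ t in Set.Ioi (N : ℝ), ((Int.fract t : ℝ) : ℂ) * (t : ℂ) ^ (-(s + 1)) := by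
  unfold fractTail mellin
  rw [← integral_indicator measurableSet_Ioi, ← integral_indicator measurableSet_Ioi]
  congr 1
  ext t
  have h0 : (0 : ℝ) ≤ N := N.cast_nonneg
  by_cases h : (N : ℝ) < t
  · rw [Set.indicator_of_mem (by simp; linarith), Set.indicator_of_mem (by simpa using h),
      Set.indicator_of_mem (by simpa using h), smul_eq_mul, mul_comm]
    congr 2
    ring
  · rw [Set.indicator_of_notMem (s := Set.Ioi (N : ℝ)) (by simpa using h)]
    simp [Set.indicator, h]

lemma differentiableAt_fractTail {N : ℕ} (hN : 1 ≤ N) {s : ℂ} (hs : 0 < s.re) :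
    DifferentiableAt ℂ (fractTail N) s := by
  have h0 : (1 : ℝ) ≤ N := by exact_mod_cast hN
  have hb : ∀ t : ℝ, ‖((Int.fract t : ℝ) : ℂ)‖ ≤ 1 := fun t ↦ by
    rw [norm_real, Real.norm_of_nonneg (Int.fract_nonneg t)]
    exact (Int.fract_lt_one t).le
  have hm : Measurable ((Set.Ioi (N : ℝ)).indicator fun t ↦ ((Int.fract t : ℝ) : ℂ)) :=
    (measurable_ofReal.comp measurable_fract).indicator measurableSet_Ioi
  have hbi : ∀ t : ℝ, ‖(Set.Ioi (N : ℝ)).indicator (fun t ↦ ((Int.fract t : ℝ) : ℂ)) t‖ ≤ 1 :=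
    fun t ↦ (norm_indicator_le_norm_self _ _).trans (hb t)
  have : DifferentiableAt ℂ
      (mellin ((Set.Ioi (N : ℝ)).indicator fun t ↦ ((Int.fract t : ℝ) : ℂ))) (-s) := by
    refine mellin_differentiableAt_of_isBigO_rpow (a := 0) (b := (-s).re - 1) ?_ ?_ (by simpa) ?_ (by linarith)
    · refine LocallyIntegrable.locallyIntegrableOn ?_ _
      refine (locallyIntegrable_const (1 : ℝ)).mono hm.aestronglyMeasurable ?_
      exact Eventually.of_forall fun t ↦ by simpa using hbi t
    · simp only [neg_zero, Real.rpow_zero]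
      exact IsBigO.of_bound 1 (Eventually.of_forall fun t ↦ by simpa using hbi t)
    · refine IsBigO.of_bound 1 ?_
      have : Set.Ioo (0 : ℝ) 1 ∈ 𝓝[>] (0 : ℝ) := Ioo_mem_nhdsGT one_pos
      filter_upwards [this] with t ht
      rw [Set.indicator_of_notMem (by simp; linarith [ht.2])]
      simp only [norm_zero]; positivity
  exact this.comp s differentiable_neg.differentiableAt

lemma norm_fractTail_le {N : ℕ} (hN : 1 ≤ N) {s : ℂ} (hs : 0 < s.re) :
    ‖fractTail N s‖ ≤ (N : ℝ) ^ (-s.re) / s.re := by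
  have h0 : (0 : ℝ) < N := by exact_mod_cast hN
  rw [fractTail_eq]
  have hfint := integrableOn_Ioi_rpow_of_lt (a := -(s.re + 1)) (by linarith) h0
  refine (norm_integral_le_of_norm_le hfint ?_).trans_eq ?_
  · refine (ae_restrict_iff' measurableSet_Ioi).2 (Eventually.of_forall fun t ht ↦ ?_)
    have ht0 : 0 < t := h0.trans ht
    rw [norm_mul, norm_cpow_eq_rpow_re_of_pos ht0, norm_real,
      Real.norm_of_nonneg (Int.fract_nonneg t)]
    simp only [neg_re, add_re, one_re]
    exact mul_le_of_le_one_left (by positivity) (Int.fract_lt_one t).le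
  · rw [integral_Ioi_rpow_of_lt (by linarith) h0]
    have : -(s.re + 1) + 1 = - s.re := by ring
    rw [this, neg_div_neg_eq]

lemma sum_indicator_gt (N m : ℕ) :
    (∑ k ∈ Finset.Icc 1 m, if N < k then (1 : ℂ) else 0) = ((m - N : ℕ) : ℂ) := by
  rw [← Finset.sum_filter]
  have : (Finset.Icc 1 m).filter (N < ·) = Finset.Ioc N m := by
    ext k; simp; omega
  rw [this]; simp

lemma riemannZeta_eq_sum_add {N : ℕ} (hN : 1 ≤ N) {s : ℂ} (hs : 1 < s.re) :
    riemannZeta s = ∑ n ∈ Finset.Icc 1 N, (n : ℂ) ^ (-s) + (N : ℂ) ^ (1 - s) / (s - 1)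
      - s * fractTail N s := by
  have h0 : (0 : ℝ) < N := by exact_mod_cast hN
  have h1 : (1 : ℝ) ≤ N := by exact_mod_cast hN
  have hs1 : s - 1 ≠ 0 := by
    intro h; have := congrArg re h; simp at this; linarith
  have hs0 : s ≠ 0 := by
    intro h; have := congrArg re h; simp at this; linarith
  have hsum : LSeriesSummable 1 s := LSeriesSummable_one_iff.2 hs
  have hO : (fun n ↦ ∑ k ∈ Finset.Icc 1 n, ‖(if N < k then (1 : ℂ) else 0)‖) =O[atTop] fun n ↦ (n : ℝ) ^ (1 : ℝ) := by
    refine IsBigO.of_bound 1 (Eventually.of_forall fun n ↦ ?_)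
    rw [Real.norm_of_nonneg (by positivity)]
    have : ∑ k ∈ Finset.Icc 1 n, ‖(if N < k then (1 : ℂ) else 0)‖ ≤ ∑ k ∈ Finset.Icc 1 n, (1 : ℝ) :=
      Finset.sum_le_sum fun k _ ↦ by split_ifs <;> simp
    simpa using this
  have hL := LSeries_eq_mul_integral' (fun k ↦ if N < k then (1 : ℂ) else 0) zero_le_one hs hO
  have hA : LSeries (fun k ↦ if N < k then (1 : ℂ) else 0) s
      = riemannZeta s - ∑ n ∈ Finset.Icc 1 N, (n : ℂ) ^ (-s) := by
    rw [← LSeries_one_eq_riemannZeta hs, eq_sub_iff_add_eq, LSeries, LSeries]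
    have hs2 : Summable fun n ↦ LSeries.term (fun k ↦ if N < k then (1 : ℂ) else 0) s n :=
      LSeriesSummable_of_sum_norm_bigO hO zero_le_one hs
    have hfin : ∑ n ∈ Finset.Icc 1 N, (n : ℂ) ^ (-s)
        = ∑' n, (if n ∈ Finset.Icc 1 N then (n : ℂ) ^ (-s) else 0) := by
      rw [tsum_eq_sum (s := Finset.Icc 1 N) (fun n hn ↦ if_neg hn)]
      exact Finset.sum_congr rfl fun n hn ↦ (if_pos hn).symm
    have hs3 : Summable fun n : ℕ ↦ (if n ∈ Finset.Icc 1 N then (n : ℂ) ^ (-s) else 0) :=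
      summable_of_ne_finset_zero (s := Finset.Icc 1 N) fun n hn ↦ if_neg hn
    rw [hfin, ← hs2.tsum_add hs3]
    congr 1
    ext n
    rcases Nat.eq_zero_or_pos n with rfl | hn
    · simp
    · rw [LSeries.term_of_ne_zero hn.ne', LSeries.term_of_ne_zero hn.ne']
      by_cases h : N < n
      · simp [h]
      · have : n ∈ Finset.Icc 1 N := by simp; omega
        rw [if_neg h, if_pos this, cpow_neg]; simp
  have hB : ∫ t in Set.Ioi (1 : ℝ), (∑ k ∈ Finset.Icc 1 ⌊t⌋₊, if N < k then (1 : ℂ) else 0) * (t : ℂ) ^ (-(s + 1))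
      = ∫ t in Set.Ioi (N : ℝ), ((t : ℂ) ^ (-s) - N * (t : ℂ) ^ (-(s + 1)) - ((Int.fract t : ℝ) : ℂ) * (t : ℂ) ^ (-(s + 1))) := by
    rw [← integral_indicator measurableSet_Ioi, ← integral_indicator measurableSet_Ioi]
    congr 1
    ext t
    simp only [sum_indicator_gt]
    by_cases h : (N : ℝ) < t
    · have ht : (0 : ℝ) < t := h0.trans h
      rw [Set.indicator_of_mem (by simp; linarith), Set.indicator_of_mem (by simpa using h)]
      have hfl : N ≤ ⌊t⌋₊ := Nat.le_floor h.le
      have h3 : ((⌊t⌋₊ : ℝ) : ℂ) = t - ((Int.fract t : ℝ) : ℂ) := by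
        rw [← ofReal_sub, Int.self_sub_fract, ← natCast_floor_eq_intCast_floor ht.le]
      have h4 : (t : ℂ) ^ (-s) = t * (t : ℂ) ^ (-(s + 1)) := by
        have : -s = 1 + (-(s + 1)) := by ring
        rw [this, cpow_add _ _ (by exact_mod_cast ht.ne'), cpow_one]
      push_cast [Nat.cast_sub hfl] at h3 ⊢
      rw [h4, h3]; ring
    · rw [Set.indicator_of_notMem (s := Set.Ioi (N : ℝ)) (by simpa using h)]
      have : ⌊t⌋₊ - N = 0 := Nat.sub_eq_zero_of_le (Nat.floor_le_of_le (not_lt.1 h))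
      simp [this]
  have i1 := integrableOn_Ioi_cpow_of_lt (a := -s) (by simpa using hs) h0
  have i2 := integrableOn_Ioi_cpow_of_lt (a := -(s + 1)) (by simp; linarith) h0
  have i3 : IntegrableOn (fun t : ℝ ↦ ((Int.fract t : ℝ) : ℂ) * (t : ℂ) ^ (-(s + 1))) (Set.Ioi (N : ℝ)) := by
    refine Integrable.bdd_mul (c := 1) i2 (measurable_ofReal.comp measurable_fract).aestronglyMeasurable ?_
    refine Eventually.of_forall fun t ↦ ?_
    rw [norm_real, Real.norm_of_nonneg (Int.fract_nonneg t)]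
    exact (Int.fract_lt_one t).le
  rw [hB, hA, integral_sub (f := fun t : ℝ ↦ (t : ℂ) ^ (-s) - N * (t : ℂ) ^ (-(s + 1)))
      (i1.sub (i2.const_mul _)) i3, integral_sub i1 (i2.const_mul _),
    ← fractTail_eq, integral_const_mul, integral_Ioi_cpow_of_lt (by simpa using hs) h0,
    integral_Ioi_cpow_of_lt (by simp; linarith) h0] at hL
  rw [sub_eq_iff_eq_add] at hL
  rw [hL]
  have e1 : -(s + 1) + 1 = -s := by ring
  have e2 : -s + 1 = 1 - s := by ring
  have e3 : (N : ℂ) ^ (1 - s) = N * (N : ℂ) ^ (-s) := by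
    rw [sub_eq_add_neg, cpow_add _ _ (by exact_mod_cast h0.ne'), cpow_one]
  have hs1' : (1 - s) ≠ 0 := by rw [← neg_sub]; exact neg_ne_zero.2 hs1
  rw [e1, e2, ofReal_natCast, e3]
  field_simp
  ring

lemma norm_truncated_zeta_le {N : ℕ} (hN : 1 ≤ N) {r : ℝ} (hr : 0 < r) (hr2 : r ≤ 1 / 2) {z : ℂ}
    (hz : 1 - r ≤ z.re) (h1 : 1 ≤ ‖z - 1‖) (h2 : ‖z‖ ≤ 4 * N) :
    ‖∑ n ∈ Finset.Icc 1 N, (n : ℂ) ^ (-z) + (N : ℂ) ^ (1 - z) / (z - 1) - z * fractTail N z‖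
      ≤ (10 + 1 / r) * (N : ℝ) ^ (2 * r) := by
  have h0 : (0 : ℝ) < N := by exact_mod_cast hN
  have h0' : (1 : ℝ) ≤ N := by exact_mod_cast hN
  have hNr : (1 : ℝ) ≤ (N : ℝ) ^ r := Real.one_le_rpow h0' hr.le
  have h2r : (N : ℝ) ^ (2 * r) = (N : ℝ) ^ r * (N : ℝ) ^ r := by
    rw [← Real.rpow_add h0]; ring_nf
  have hzre : 0 < z.re := by linarith
  have a1 : ‖∑ n ∈ Finset.Icc 1 N, (n : ℂ) ^ (-z)‖ ≤ (N : ℝ) ^ r * (1 + (N : ℝ) ^ r / r) := by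
    calc ‖∑ n ∈ Finset.Icc 1 N, (n : ℂ) ^ (-z)‖ ≤ ∑ n ∈ Finset.Icc 1 N, (N : ℝ) ^ r * (n : ℝ)⁻¹ := by
          refine norm_sum_le_of_le _ fun n hn ↦ ?_
          have hn1 := (Finset.mem_Icc.1 hn)
          have hn0 : (0 : ℝ) < n := by exact_mod_cast hn1.1
          have hn1' : (1 : ℝ) ≤ n := by exact_mod_cast hn1.1
          rw [norm_natCast_cpow_of_pos hn1.1, neg_re]
          calc (n : ℝ) ^ (-z.re) ≤ (n : ℝ) ^ (r + (-1)) :=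
                Real.rpow_le_rpow_of_exponent_le hn1' (by linarith)
            _ = (n : ℝ) ^ r * (n : ℝ)⁻¹ := by rw [Real.rpow_add hn0, Real.rpow_neg_one]
            _ ≤ _ := by
                gcongr
                exact_mod_cast hn1.2
      _ = (N : ℝ) ^ r * (harmonic N : ℝ) := by
          rw [← Finset.mul_sum, harmonic_eq_sum_Icc]
          push_cast; rfl
      _ ≤ (N : ℝ) ^ r * (1 + (N : ℝ) ^ r / r) := by
          gcongr
          exact (harmonic_le_one_add_log N).trans (by gcongr; exact Real.log_le_rpow_div h0.le hr)
  have a2 : ‖(N : ℂ) ^ (1 - z) / (z - 1)‖ ≤ (N : ℝ) ^ r := by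
    rw [norm_div, norm_natCast_cpow_of_pos hN]
    refine (div_le_self (by positivity) h1).trans ?_
    exact Real.rpow_le_rpow_of_exponent_le h0' (by simp; linarith)
  have a3 : ‖z * fractTail N z‖ ≤ 8 * (N : ℝ) ^ r := by
    rw [norm_mul]
    calc ‖z‖ * ‖fractTail N z‖ ≤ (4 * N) * ((N : ℝ) ^ (-z.re) / z.re) := by
          gcongr; exact norm_fractTail_le hN hzre
      _ ≤ (4 * N) * ((N : ℝ) ^ (r + (-1)) / (1 / 2)) := by
          have : (N : ℝ) ^ (-z.re) ≤ (N : ℝ) ^ (r + (-1)) :=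
            Real.rpow_le_rpow_of_exponent_le h0' (by linarith)
          gcongr
          linarith
      _ = _ := by
          rw [Real.rpow_add h0, Real.rpow_neg_one]; field_simp; norm_num
  have := norm_sub_le (∑ n ∈ Finset.Icc 1 N, (n : ℂ) ^ (-z) + (N : ℂ) ^ (1 - z) / (z - 1)) (z * fractTail N z)
  have := norm_add_le (∑ n ∈ Finset.Icc 1 N, (n : ℂ) ^ (-z)) ((N : ℂ) ^ (1 - z) / (z - 1))
  have e : (10 + 1 / r) * ((N : ℝ) ^ r * (N : ℝ) ^ r)
     = 10 * ((N : ℝ) ^ r * (N : ℝ) ^ r) + (N : ℝ) ^ r * ((N : ℝ) ^ r / r) := by field_simp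
  rw [h2r, e]
  nlinarith

lemma norm_iteratedDeriv_riemannZeta_le {r : ℝ} (hr : 0 < r) (hr2 : r ≤ 1 / 2) :
    ∃ C > 0, ∀ s : ℂ, 1 < s.re → s.re ≤ 2 → 2 ≤ |s.im| → ∀ j ≤ 3,
      ‖iteratedDeriv j riemannZeta s‖ ≤ C * |s.im| ^ (2 * r) := by
  refine ⟨6 * (10 + 1 / r) / r ^ 3, by positivity, fun s hs1 hs2 hs3 j hj ↦ ?_⟩
  set N := ⌊|s.im|⌋₊ with hNdef
  have hN2 : 2 ≤ N := Nat.le_floor (by exact_mod_cast hs3)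
  have hN : 1 ≤ N := by omega
  have hN2' : (2 : ℝ) ≤ N := by exact_mod_cast hN2
  have hNle : (N : ℝ) ≤ |s.im| := Nat.floor_le (by positivity)
  have hlt : |s.im| < N + 1 := Nat.lt_floor_add_one _
  set H : ℂ → ℂ := fun z ↦ ∑ n ∈ Finset.Icc 1 N, (n : ℂ) ^ (-z) + (N : ℂ) ^ (1 - z) / (z - 1)
    - z * fractTail N z with hH
  have hball : ∀ z ∈ Metric.closedBall s r, 1 - r ≤ z.re ∧ 1 ≤ ‖z - 1‖ ∧ ‖z‖ ≤ 4 * N := by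
    intro z hz
    rw [mem_closedBall_iff_norm] at hz
    have h1 := (abs_re_le_norm (z - s)).trans hz
    have h2 := (abs_im_le_norm (z - s)).trans hz
    simp only [sub_re, sub_im] at h1 h2
    have h3 := abs_sub_abs_le_abs_sub s.im z.im
    rw [abs_sub_comm] at h3
    have h4 := abs_sub_abs_le_abs_sub z.im s.im
    have h5 := abs_le.1 h1
    refine ⟨by linarith, ?_, ?_⟩
    · have := abs_im_le_norm (z - 1)
      simp only [sub_im, one_im, sub_zero] at this
      linarith
    · have h6 := norm_le_abs_re_add_abs_im z
      have h7 : |z.re| ≤ 3 := abs_le.2 ⟨by linarith, by linarith⟩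
      linarith
  have heq : riemannZeta =ᶠ[𝓝 s] H := by
    have : {z : ℂ | 1 < z.re} ∈ 𝓝 s := (isOpen_lt continuous_const continuous_re).mem_nhds hs1
    filter_upwards [this] with z hz
    exact riemannZeta_eq_sum_add hN hz
  have hd : DifferentiableOn ℂ H (Metric.closedBall s r) := by
    intro z hz
    obtain ⟨b1, b2, -⟩ := hball z hz
    have hz1 : z - 1 ≠ 0 := norm_pos_iff.1 (by linarith)
    have hNc : (N : ℂ) ≠ 0 := by exact_mod_cast (by omega : N ≠ 0)
    have hfr := differentiableAt_fractTail (s := z) hN (by linarith)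
    have hsum : DifferentiableAt ℂ (fun z : ℂ ↦ ∑ n ∈ Finset.Icc 1 N, (n : ℂ) ^ (-z)) z := by
      refine DifferentiableAt.fun_sum fun n hn ↦ ?_
      have hn0 : (n : ℂ) ≠ 0 := by
        have := (Finset.mem_Icc.1 hn).1
        exact_mod_cast (by omega : n ≠ 0)
      exact differentiableAt_id.neg.const_cpow (Or.inl hn0)
    have hpow : DifferentiableAt ℂ (fun z : ℂ ↦ (N : ℂ) ^ (1 - z)) z :=
      (differentiableAt_id.const_sub 1).const_cpow (Or.inl hNc)
    have hquot : DifferentiableAt ℂ (fun z : ℂ ↦ (N : ℂ) ^ (1 - z) / (z - 1)) z :=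
      hpow.fun_div (by fun_prop) hz1
    have hprod : DifferentiableAt ℂ (fun z : ℂ ↦ z * fractTail N z) z :=
      DifferentiableAt.fun_mul (by fun_prop) hfr
    exact ((hsum.fun_add hquot).fun_sub hprod).differentiableWithinAt
  have hdc : DiffContOnCl ℂ H (Metric.ball s r) :=
    ⟨hd.mono Metric.ball_subset_closedBall,
      hd.continuousOn.mono Metric.closure_ball_subset_closedBall⟩
  have hB : ∀ z ∈ Metric.sphere s r, ‖H z‖ ≤ (10 + 1 / r) * |s.im| ^ (2 * r) := by
    intro z hz
    obtain ⟨b1, b2, b3⟩ := hball z (Metric.sphere_subset_closedBall hz)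
    refine (norm_truncated_zeta_le hN hr hr2 b1 b2 b3).trans ?_
    gcongr
  rw [heq.iteratedDeriv_eq]
  refine (norm_iteratedDeriv_le_of_forall_mem_sphere_norm_le j hr hdc hB).trans ?_
  have f1 : (j.factorial : ℝ) ≤ 6 := by
    have : j.factorial ≤ Nat.factorial 3 := Nat.factorial_le hj
    exact_mod_cast this
  have f2 : r ^ 3 ≤ r ^ j := pow_le_pow_of_le_one hr.le (by linarith) hj
  calc (j.factorial : ℝ) * ((10 + 1 / r) * |s.im| ^ (2 * r)) / r ^ j
      ≤ 6 * ((10 + 1 / r) * |s.im| ^ (2 * r)) / r ^ 3 := by gcongr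
    _ = _ := by ring

lemma norm_riemannZeta_one_add_le :
    ∃ K > 0, ∀ x : ℝ, 0 < x → x ≤ 1 → ‖riemannZeta (1 + x)‖ ≤ K / x := by
  have hc : Continuous fun x : ℝ ↦ riemannZeta₁ (1 + x) := by
    have := differentiable_riemannZeta₁.continuous
    fun_prop
  obtain ⟨K, hK⟩ := (isCompact_Icc (a := (0 : ℝ)) (b := 1)).exists_bound_of_continuousOn
    hc.continuousOn
  refine ⟨max K 1, by positivity, fun x hx hx1 ↦ ?_⟩
  have hne : (1 + x : ℂ) ≠ 1 := by simpa using hx.ne'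
  rw [riemannZeta_eq_inv_sub_mul hne, norm_mul, add_sub_cancel_left, norm_inv, norm_real,
    Real.norm_of_nonneg hx.le, inv_mul_eq_div]
  gcongr
  exact (hK x ⟨hx.le, hx1⟩).trans (le_max_left _ _)

lemma one_le_norm_riemannZeta_product {x : ℝ} (hx : 0 < x) (y : ℝ) :
    1 ≤ ‖riemannZeta (1 + x)‖ ^ 3 * ‖riemannZeta (1 + x + I * y)‖ ^ 4 *
      ‖riemannZeta (1 + x + 2 * I * y)‖ := by
  have := DirichletCharacter.norm_LFunction_product_ge_one (1 : DirichletCharacter ℂ 1) hx y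
  simpa only [DirichletCharacter.LFunctionTrivChar, DirichletCharacter.LFunction_modOne_eq,
    norm_mul, norm_pow, ge_iff_le] using this

lemma le_norm_riemannZeta {ε C : ℝ} (hε : 0 < ε) (hε1 : ε ≤ 1) (hC : 0 < C)
    (hbd : ∀ s : ℂ, 1 < s.re → s.re ≤ 2 → 2 ≤ |s.im| → ∀ j ≤ 3,
      ‖iteratedDeriv j riemannZeta s‖ ≤ C * |s.im| ^ ε) :
    ∃ c > 0, ∀ s : ℂ, 1 < s.re → s.re ≤ 2 → 2 ≤ |s.im| →
      c / (|s.im| ^ ε) ^ 4 ≤ ‖riemannZeta s‖ := by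
  obtain ⟨K, hK, hKb⟩ := norm_riemannZeta_one_add_le
  set M := 2 * C * K ^ 3 with hM
  have hM0 : 0 < M := by positivity
  have main : ∀ s : ℂ, 1 < s.re → s.re ≤ 2 → 2 ≤ |s.im| →
      (s.re - 1) ^ 3 / (M * |s.im| ^ ε) ≤ ‖riemannZeta s‖ ^ 4 := by
    intro s h1 h2 h3
    have hx : 0 < s.re - 1 := by linarith
    have p := one_le_norm_riemannZeta_product hx s.im
    have e1 : (1 + ((s.re - 1 : ℝ) : ℂ) + I * s.im) = s := by
      apply Complex.ext <;> simp
    have hT := hbd (1 + ((s.re - 1 : ℝ) : ℂ) + 2 * I * s.im) (by simp; linarith) (by simp; linarith)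
      (by simp [abs_mul]; linarith) 0 (by norm_num)
    rw [iteratedDeriv_zero] at hT
    have e2 : |(1 + ((s.re - 1 : ℝ) : ℂ) + 2 * I * s.im).im| = 2 * |s.im| := by
      simp [abs_mul]
    rw [e2, Real.mul_rpow (by norm_num) (by positivity)] at hT
    have h2e : (2 : ℝ) ^ ε ≤ 2 := by
      simpa using Real.rpow_le_rpow_of_exponent_le (by norm_num : (1 : ℝ) ≤ 2) hε1
    have hw : 0 < |s.im| ^ ε := by positivity
    have hT' : ‖riemannZeta (1 + ((s.re - 1 : ℝ) : ℂ) + 2 * I * s.im)‖ ≤ 2 * C * |s.im| ^ ε := by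
      refine hT.trans ?_
      have := mul_le_mul_of_nonneg_left h2e (by positivity : 0 ≤ C * |s.im| ^ ε)
      linarith
    have hK' := hKb _ hx (by linarith)
    rw [e1] at p
    have : 1 ≤ (K / (s.re - 1)) ^ 3 * ‖riemannZeta s‖ ^ 4 * (2 * C * |s.im| ^ ε) := by
      refine p.trans ?_
      gcongr
    rw [div_le_iff₀ (by positivity)]
    have h4 : (K / (s.re - 1)) ^ 3 * ‖riemannZeta s‖ ^ 4 * (2 * C * |s.im| ^ ε)
       = (‖riemannZeta s‖ ^ 4 * (M * |s.im| ^ ε)) / (s.re - 1) ^ 3 := by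
      rw [hM]; field_simp
    rw [h4, le_div_iff₀ (by positivity)] at this
    linarith
  set κ := min 1 (1 / (16 * C ^ 4 * M)) with hκ
  have hκ0 : 0 < κ := by positivity
  have hκ1 : κ ≤ 1 := min_le_left _ _
  have hκ2 : 16 * C ^ 4 * M * κ ≤ 1 := by
    have : κ ≤ 1 / (16 * C ^ 4 * M) := min_le_right _ _
    rw [le_div_iff₀ (by positivity)] at this
    linarith
  set c := (κ ^ 3 / M) ^ (1 / 4 : ℝ) with hc
  have hc0 : 0 < c := by positivity
  have hc4 : c ^ 4 = κ ^ 3 / M := by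
    rw [hc, ← Real.rpow_natCast, ← Real.rpow_mul (by positivity)]; norm_num
  have hcκ : 2 * C * κ ≤ c := by
    refine le_of_pow_le_pow_left₀ (n := 4) (by norm_num) hc0.le ?_
    rw [hc4, le_div_iff₀ hM0]
    have := mul_le_mul_of_nonneg_right hκ2 (by positivity : 0 ≤ κ ^ 3)
    nlinarith
  have far : ∀ s : ℂ, 1 < s.re → s.re ≤ 2 → 2 ≤ |s.im| → κ / (|s.im| ^ ε) ^ 5 ≤ s.re - 1 →
      c / (|s.im| ^ ε) ^ 4 ≤ ‖riemannZeta s‖ := by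
    intro s h1 h2 h3 h4
    have hw : 0 < |s.im| ^ ε := by positivity
    refine le_of_pow_le_pow_left₀ (n := 4) (by norm_num) (norm_nonneg _) ?_
    refine le_trans ?_ (main s h1 h2 h3)
    rw [div_pow, hc4]
    calc κ ^ 3 / M / ((|s.im| ^ ε) ^ 4) ^ 4 = (κ / (|s.im| ^ ε) ^ 5) ^ 3 / (M * |s.im| ^ ε) := by
          field_simp
      _ ≤ _ := by gcongr
  refine ⟨c / 2, by positivity, fun s h1 h2 h3 ↦ ?_⟩
  have hw1 : 1 ≤ |s.im| ^ ε := Real.one_le_rpow (by linarith) hε.le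
  have hw : 0 < |s.im| ^ ε := by positivity
  rcases le_total (κ / (|s.im| ^ ε) ^ 5) (s.re - 1) with h | h
  · refine le_trans ?_ (far s h1 h2 h3 h)
    gcongr
    linarith
  have hη : κ / (|s.im| ^ ε) ^ 5 ≤ 1 := by
    rw [div_le_one (by positivity)]
    exact hκ1.trans (one_le_pow₀ hw1)
  have hη0 : 0 < κ / (|s.im| ^ ε) ^ 5 := by positivity
  set s' : ℂ := ⟨1 + κ / (|s.im| ^ ε) ^ 5, s.im⟩ with hs'
  have hfar := far s' (by simp [hs']; positivity) (by simp [hs']; linarith) h3 (by simp [hs'])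
  have hconv : Convex ℝ {z : ℂ | 1 < z.re ∧ z.re ≤ 2 ∧ z.im = s.im} := by
    have e : {z : ℂ | 1 < z.re ∧ z.re ≤ 2 ∧ z.im = s.im} =
      {z : ℂ | 1 < z.re} ∩ ({z : ℂ | z.re ≤ 2} ∩ {z : ℂ | z.im = s.im}) := rfl
    rw [e]
    exact (convex_halfSpace_re_gt 1).inter ((convex_halfSpace_re_le 2).inter
      (convex_hyperplane (by exact IsLinearMap.mk add_im (by simp)) _))
  have mv := hconv.norm_image_sub_le_of_norm_deriv_le (𝕜 := ℂ) (f := riemannZeta)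
    (C := C * |s.im| ^ ε) (x := s) (y := s')
    (fun z hz ↦ differentiableAt_riemannZeta (by
      rintro rfl
      simp at hz))
    (fun z hz ↦ by
      have := hbd z hz.1 hz.2.1 (by rw [hz.2.2]; exact h3) 1 (by norm_num)
      rwa [iteratedDeriv_one, hz.2.2] at this)
    ⟨h1, h2, rfl⟩ ⟨by simp [hs']; positivity, by simp [hs']; linarith, rfl⟩
  have hdist : ‖s' - s‖ ≤ κ / (|s.im| ^ ε) ^ 5 := by
    have : s' - s = ((1 + κ / (|s.im| ^ ε) ^ 5 - s.re : ℝ) : ℂ) := by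
      apply Complex.ext
      · rw [ofReal_re, sub_re]
      · rw [ofReal_im, sub_im, sub_self]
    rw [this, norm_real, Real.norm_eq_abs, abs_le]
    constructor <;> linarith
  have h5 : C * |s.im| ^ ε * ‖s' - s‖ ≤ c / 2 / (|s.im| ^ ε) ^ 4 := by
    calc C * |s.im| ^ ε * ‖s' - s‖ ≤ C * |s.im| ^ ε * (κ / (|s.im| ^ ε) ^ 5) := by gcongr
      _ = C * κ / (|s.im| ^ ε) ^ 4 := by field_simp
      _ ≤ _ := by gcongr; linarith
  have h6 := norm_sub_norm_le (riemannZeta s') (riemannZeta s)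
  have h7 : c / (|s'.im| ^ ε) ^ 4 = 2 * (c / 2 / (|s.im| ^ ε) ^ 4) := by
    simp only [hs']; ring
  rw [h7] at hfar
  linarith

lemma deriv_deriv_neg_logDeriv_sub {f : ℂ → ℂ} {s : ℂ} (hf : AnalyticAt ℂ f s) (h0 : f s ≠ 0) :
    deriv (deriv fun z ↦ -(deriv f z / f z) - f z) s =
      -(iteratedDeriv 3 f s / f s - 3 * (iteratedDeriv 1 f s * iteratedDeriv 2 f s / f s ^ 2) +
        2 * (iteratedDeriv 1 f s ^ 3 / f s ^ 3)) - iteratedDeriv 2 f s := by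
  have i1 : iteratedDeriv 1 f = deriv f := iteratedDeriv_one
  have i2 : iteratedDeriv 2 f = deriv (deriv f) := by rw [iteratedDeriv_succ, i1]
  have i3 : iteratedDeriv 3 f = deriv (deriv (deriv f)) := by rw [iteratedDeriv_succ, i2]
  rw [i1, i2, i3]
  have hev : deriv (fun z ↦ -(deriv f z / f z) - f z) =ᶠ[𝓝 s]
      fun z ↦ -((deriv (deriv f) z * f z - deriv f z * deriv f z) / f z ^ 2) - deriv f z := by
    filter_upwards [hf.eventually_analyticAt, hf.continuousAt.eventually_ne h0] with z hz hz0
    exact ((hz.deriv.differentiableAt.hasDerivAt.div hz.differentiableAt.hasDerivAt hz0).neg.sub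
      hz.differentiableAt.hasDerivAt).deriv
  rw [hev.deriv_eq]
  have d0 := hf.differentiableAt.hasDerivAt
  have d1 := hf.deriv.differentiableAt.hasDerivAt
  have d2 := hf.deriv.deriv.differentiableAt.hasDerivAt
  have := (((d2.mul d0).sub (d1.mul d1)).div (d0.pow 2) (pow_ne_zero 2 h0)).neg.sub d1
  refine this.deriv.trans ?_
  simp only [Pi.mul_apply, Pi.sub_apply, Pi.pow_apply]
  push_cast
  field_simp
  ring

lemma analyticAt_riemannZeta {s : ℂ} (hs : s ≠ 1) : AnalyticAt ℂ riemannZeta s := by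
  refine DifferentiableOn.analyticAt (s := {1}ᶜ) (fun z hz ↦ ?_) (isOpen_compl_singleton.mem_nhds hs)
  exact (differentiableAt_riemannZeta hz).differentiableWithinAt

lemma exists_norm_deriv_deriv_le_of_two_le :
    ∃ C > 0, ∀ s : ℂ, 1 < s.re → s.re ≤ 2 → 2 ≤ |s.im| →
      ‖deriv (deriv fun z ↦ -(deriv riemannZeta z / riemannZeta z) - riemannZeta z) s‖
        ≤ C * |s.im| ^ (3 / 8 : ℝ) := by
  obtain ⟨C, hC, hb⟩ := norm_iteratedDeriv_riemannZeta_le (r := 1 / 80) (by norm_num) (by norm_num)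
  obtain ⟨c, hc, hl⟩ := le_norm_riemannZeta (by norm_num) (by norm_num) hC hb
  refine ⟨(C / c) + 3 * (C / c) ^ 2 + 2 * (C / c) ^ 3 + C, by positivity, fun s h1 h2 h3 ↦ ?_⟩
  have hs1 : s ≠ 1 := by rintro rfl; simp at h1
  have b1 := hb s h1 h2 h3 1 (by norm_num)
  have b2 := hb s h1 h2 h3 2 (by norm_num)
  have b3 := hb s h1 h2 h3 3 (by norm_num)
  have l := hl s h1 h2 h3
  have hw1 : 1 ≤ |s.im| ^ (2 * (1 / 80) : ℝ) := Real.one_le_rpow (by linarith) (by norm_num)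
  have hw15 : |s.im| ^ (3 / 8 : ℝ) = (|s.im| ^ (2 * (1 / 80) : ℝ)) ^ 15 := by
    rw [← Real.rpow_natCast, ← Real.rpow_mul (by positivity)]; norm_num
  rw [hw15, deriv_deriv_neg_logDeriv_sub (analyticAt_riemannZeta hs1)
    (riemannZeta_ne_zero_of_one_le_re h1.le)]
  set w := |s.im| ^ (2 * (1 / 80) : ℝ)
  have hw : 0 < w := by positivity
  have hm : 0 < c / w ^ 4 := by positivity
  have hd : C * w / (c / w ^ 4) = C / c * w ^ 5 := by field_simp
  have t1 : ‖iteratedDeriv 3 riemannZeta s / riemannZeta s‖ ≤ C / c * w ^ 15 := by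
    rw [norm_div]
    calc _ ≤ C * w / (c / w ^ 4) := by gcongr
      _ = C / c * w ^ 5 := hd
      _ ≤ _ := by gcongr; norm_num
  have t2 : ‖iteratedDeriv 1 riemannZeta s * iteratedDeriv 2 riemannZeta s / riemannZeta s ^ 2‖
      ≤ (C / c) ^ 2 * w ^ 15 := by
    rw [norm_div, norm_mul, norm_pow]
    calc _ ≤ (C * w) * (C * w) / (c / w ^ 4) ^ 2 := by gcongr
      _ = (C * w / (c / w ^ 4)) ^ 2 := by ring
      _ = (C / c) ^ 2 * w ^ 10 := by rw [hd]; ring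
      _ ≤ _ := by gcongr; norm_num
  have t3 : ‖iteratedDeriv 1 riemannZeta s ^ 3 / riemannZeta s ^ 3‖ ≤ (C / c) ^ 3 * w ^ 15 := by
    rw [norm_div, norm_pow, norm_pow]
    calc _ ≤ (C * w) ^ 3 / (c / w ^ 4) ^ 3 := by gcongr
      _ = (C * w / (c / w ^ 4)) ^ 3 := by ring
      _ = _ := by rw [hd]; ring
  have t4 : ‖iteratedDeriv 2 riemannZeta s‖ ≤ C * w ^ 15 := by
    refine b2.trans ?_
    gcongr
    exact le_self_pow₀ hw1 (by norm_num)
  refine (norm_sub_le _ _).trans ?_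
  rw [norm_neg]
  refine (add_le_add (norm_add_le _ _) le_rfl).trans ?_
  refine (add_le_add (add_le_add (norm_sub_le _ _) le_rfl) le_rfl).trans ?_
  rw [norm_mul (3 : ℂ), norm_mul (2 : ℂ), norm_ofNat, norm_ofNat]
  linarith

lemma riemannZeta₁_ne_zero_of_one_le_re {s : ℂ} (hs : 1 ≤ s.re) : riemannZeta₁ s ≠ 0 := by
  rcases eq_or_ne s 1 with rfl | h
  · simp
  · have := riemannZeta_ne_zero_of_one_le_re hs
    rw [riemannZeta_eq_inv_sub_mul h] at this
    exact right_ne_zero_of_mul this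

lemma exists_norm_deriv_deriv_le_of_le_two :
    ∃ C > 0, ∀ s : ℂ, 1 < s.re → s.re ≤ 2 → |s.im| ≤ 2 →
      ‖deriv (deriv fun z ↦ -(deriv riemannZeta z / riemannZeta z) - riemannZeta z) s‖ ≤ C := by
  set G : ℂ → ℂ := fun z ↦ -(deriv riemannZeta₁ z / riemannZeta₁ z) - riemannZeta₀ z with hG
  have hGa : ∀ s : ℂ, 1 ≤ s.re → AnalyticAt ℂ G s := fun s hs ↦
    ((differentiable_riemannZeta₁.analyticAt s).deriv.div (differentiable_riemannZeta₁.analyticAt s)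
      (riemannZeta₁_ne_zero_of_one_le_re hs)).neg.sub (differentiable_riemannZeta₀.analyticAt s)
  have hcont : ContinuousOn (deriv (deriv G)) (Set.Icc 1 2 ×ℂ Set.Icc (-2) 2) := fun s hs ↦
    (hGa s hs.1.1).deriv.deriv.continuousAt.continuousWithinAt
  obtain ⟨C, hC⟩ := (isCompact_Icc.reProdIm isCompact_Icc).exists_bound_of_continuousOn hcont
  refine ⟨max C 1, by positivity, fun s h1 h2 h3 ↦ ?_⟩
  have hev : (fun z ↦ -(deriv riemannZeta z / riemannZeta z) - riemannZeta z) =ᶠ[𝓝 s] G := by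
    have : {z : ℂ | 1 < z.re} ∈ 𝓝 s := (isOpen_lt continuous_const continuous_re).mem_nhds h1
    filter_upwards [this] with z hz
    have hz1 : z ≠ 1 := by rintro rfl; simp at hz
    have hz1' : z - 1 ≠ 0 := sub_ne_zero.2 hz1
    have hne := riemannZeta₁_ne_zero_of_one_le_re (le_of_lt hz)
    have e := riemannZeta_eq_inv_sub_mul hz1
    simp only [hG]
    rw [deriv_riemannZeta_eq_neg_inv_sub_sq_mul_add hz1]
    nth_rewrite 2 [riemannZeta_eq_inv_sub_add hz1]
    rw [e]
    field_simp
    ring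
  rw [hev.deriv.deriv_eq]
  exact (hC s ⟨⟨h1.le, h2⟩, abs_le.1 h3⟩).trans (le_max_left _ _)

open ArithmeticFunction in
lemma LSeries_logMul_logMul_vonMangoldt_sub_one {s : ℂ} (hs : 1 < s.re) :
    LSeries.abscissaOfAbsConv (fun n ↦ (vonMangoldt n : ℂ) - 1) ≤ 1 ∧
    LSeries (LSeries.logMul (LSeries.logMul fun n ↦ (vonMangoldt n : ℂ) - 1)) s =
      deriv (deriv fun z ↦ -(deriv riemannZeta z / riemannZeta z) - riemannZeta z) s := by
  have hsm : ∀ z : ℂ, 1 < z.re → LSeriesSummable (fun n ↦ (vonMangoldt n : ℂ) - 1) z :=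
    fun z hz ↦ (LSeriesSummable_vonMangoldt hz).sub (LSeriesSummable_one_iff.2 hz)
  have habs : LSeries.abscissaOfAbsConv (fun n ↦ (vonMangoldt n : ℂ) - 1) ≤ 1 := by
    refine LSeries.abscissaOfAbsConv_le_of_forall_lt_LSeriesSummable fun y hy ↦ hsm _ ?_
    exact_mod_cast hy
  refine ⟨habs, ?_⟩
  have hlt : LSeries.abscissaOfAbsConv (fun n ↦ (vonMangoldt n : ℂ) - 1) < s.re :=
    habs.trans_lt (by exact_mod_cast hs)
  have h2 := LSeries_iteratedDeriv (f := fun n ↦ (vonMangoldt n : ℂ) - 1) 2 hlt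
  simp only [Function.iterate_succ, Function.iterate_zero, Function.comp, id] at h2
  rw [neg_one_sq, one_mul] at h2
  rw [← h2, iteratedDeriv_succ, iteratedDeriv_one]
  have hev : LSeries (fun n ↦ (vonMangoldt n : ℂ) - 1) =ᶠ[𝓝 s]
      fun z ↦ -(deriv riemannZeta z / riemannZeta z) - riemannZeta z := by
    have : {z : ℂ | 1 < z.re} ∈ 𝓝 s := (isOpen_lt continuous_const continuous_re).mem_nhds hs
    filter_upwards [this] with z hz
    have := LSeries_sub (LSeriesSummable_vonMangoldt hz) (LSeriesSummable_one_iff.2 hz)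
    refine this.trans ?_
    rw [LSeries_vonMangoldt_eq_deriv_riemannZeta_div hz, LSeries_one_eq_riemannZeta hz, neg_div]
  exact hev.deriv.deriv_eq

open ArithmeticFunction in
lemma exists_norm_LSeries_logMul_logMul_le :
    ∃ C > 0, ∀ s : ℂ, 1 < s.re → s.re ≤ 2 →
      ‖LSeries (LSeries.logMul (LSeries.logMul fun n ↦ (vonMangoldt n : ℂ) - 1)) s‖
        ≤ C * (1 + |s.im|) ^ (3 / 8 : ℝ) := by
  obtain ⟨C₁, hC₁, h₁⟩ := exists_norm_deriv_deriv_le_of_two_le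
  obtain ⟨C₂, hC₂, h₂⟩ := exists_norm_deriv_deriv_le_of_le_two
  refine ⟨max C₁ C₂, by positivity, fun s hs hs2 ↦ ?_⟩
  rw [(LSeries_logMul_logMul_vonMangoldt_sub_one hs).2]
  rcases le_total 2 |s.im| with h | h
  · refine (h₁ s hs hs2 h).trans ?_
    gcongr
    · exact le_max_left _ _
    · linarith
  · refine (h₂ s hs hs2 h).trans ((le_max_right C₁ C₂).trans ?_)
    exact le_mul_of_one_le_right (by positivity)
      (Real.one_le_rpow (by linarith [abs_nonneg s.im]) (by norm_num))

open ArithmeticFunction in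
/-- The summatory function of `(Λ n - 1) log² n`. -/
noncomputable def logSqRemainder (x : ℝ) : ℝ :=
  ∑ n ∈ Finset.Icc 1 ⌊x⌋₊, (vonMangoldt n - 1) * Real.log n ^ 2

open ArithmeticFunction in
lemma sum_vonMangoldt_add_one_mul_log_sq_le {x : ℝ} (hx : 1 ≤ x) :
    ∑ n ∈ Finset.Icc 1 ⌊x⌋₊, (vonMangoldt n + 1) * Real.log n ^ 2 ≤ 7 * x * Real.log x ^ 2 := by
  have h1 : ∑ n ∈ Finset.Icc 1 ⌊x⌋₊, (vonMangoldt n + 1) * Real.log n ^ 2 ≤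
      ∑ n ∈ Finset.Icc 1 ⌊x⌋₊, (vonMangoldt n + 1) * Real.log x ^ 2 := by
    refine Finset.sum_le_sum fun n hn ↦ ?_
    have hn' := Finset.mem_Icc.1 hn
    have hn1 : (1 : ℝ) ≤ n := by exact_mod_cast hn'.1
    have hnx : (n : ℝ) ≤ x := (Nat.le_floor_iff (by linarith)).1 hn'.2
    have := vonMangoldt_nonneg (n := n)
    have := Real.log_nonneg hn1
    gcongr
  refine h1.trans ?_
  rw [← Finset.sum_mul, Finset.sum_add_distrib]
  have h2 := Chebyshev.psi_le_const_mul_self (x := x) (by linarith)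
  have h3 : ∑ n ∈ Finset.Icc 1 ⌊x⌋₊, vonMangoldt n = Chebyshev.psi x := by
    rw [Chebyshev.psi]; rfl
  have h4 : Real.log 4 ≤ 2 := by
    have : (4 : ℝ) = 2 ^ 2 := by norm_num
    rw [this, Real.log_pow]
    have := Real.log_two_lt_d9
    push_cast
    linarith
  have h5 : (⌊x⌋₊ : ℝ) ≤ x := Nat.floor_le (by linarith)
  rw [h3]
  simp only [Finset.sum_const, Nat.card_Icc, add_tsub_cancel_right, nsmul_eq_mul, mul_one]
  gcongr
  nlinarith

lemma logSqRemainder_of_lt_one {x : ℝ} (hx : x < 1) : logSqRemainder x = 0 := by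
  have : ⌊x⌋₊ = 0 := Nat.floor_eq_zero.2 hx
  simp [logSqRemainder, this]

lemma logSqRemainder_one : logSqRemainder 1 = 0 := by
  simp [logSqRemainder]

open ArithmeticFunction in
lemma sum_vonMangoldt_add_one_mul_log_sq_le_rpow {δ : ℝ} (hδ : 0 < δ) {x : ℝ} (hx : 1 ≤ x) :
    ∑ n ∈ Finset.Icc 1 ⌊x⌋₊, (vonMangoldt n + 1) * Real.log n ^ 2
      ≤ 28 / δ ^ 2 * x ^ (1 + δ) := by
  refine (sum_vonMangoldt_add_one_mul_log_sq_le hx).trans ?_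
  have h := Real.log_le_rpow_div (x := x) (by linarith) (half_pos hδ)
  have h0 := Real.log_nonneg hx
  calc 7 * x * Real.log x ^ 2 ≤ 7 * x * (x ^ (δ / 2) / (δ / 2)) ^ 2 := by gcongr
    _ = 28 / δ ^ 2 * (x * x ^ (δ / 2 + δ / 2)) := by
        rw [Real.rpow_add (by linarith)]; field_simp; ring
    _ = _ := by rw [add_halves, Real.rpow_add (by linarith), Real.rpow_one]

open ArithmeticFunction in
lemma abs_logSqRemainder_le {x : ℝ} :
    |logSqRemainder x| ≤ ∑ n ∈ Finset.Icc 1 ⌊x⌋₊, (vonMangoldt n + 1) * Real.log n ^ 2 := by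
  refine (Finset.abs_sum_le_sum_abs _ _).trans (Finset.sum_le_sum fun n _ ↦ ?_)
  rw [abs_mul, abs_of_nonneg (sq_nonneg (Real.log n))]
  have := vonMangoldt_nonneg (n := n)
  gcongr
  rw [abs_le]
  constructor <;> linarith

lemma abs_logSqRemainder_le_rpow {δ : ℝ} (hδ : 0 < δ) {x : ℝ} (hx : 0 ≤ x) :
    |logSqRemainder x| ≤ 28 / δ ^ 2 * x ^ (1 + δ) := by
  rcases lt_or_ge x 1 with h | h
  · rw [logSqRemainder_of_lt_one h, abs_zero]; positivity
  · exact abs_logSqRemainder_le.trans (sum_vonMangoldt_add_one_mul_log_sq_le_rpow hδ h)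

lemma measurable_logSqRemainder : Measurable logSqRemainder := by
  have : logSqRemainder = (fun m : ℕ ↦ ∑ n ∈ Finset.Icc 1 m,
    (ArithmeticFunction.vonMangoldt n - 1) * Real.log n ^ 2) ∘ Nat.floor := rfl
  rw [this]
  exact (measurable_from_nat).comp Nat.measurable_floor

open ArithmeticFunction in
lemma LSeries_eq_mul_mellin_logSqRemainder {s : ℂ} (hs : 1 < s.re) :
    LSeries (LSeries.logMul (LSeries.logMul fun n ↦ (vonMangoldt n : ℂ) - 1)) s =
      s * mellin (fun t ↦ (logSqRemainder t : ℂ)) (-s) := by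
  have hf : ∀ n : ℕ, LSeries.logMul (LSeries.logMul fun n ↦ (vonMangoldt n : ℂ) - 1) n =
      (((vonMangoldt n - 1) * Real.log n ^ 2 : ℝ) : ℂ) := fun n ↦ by
    simp only [LSeries.logMul]
    push_cast
    rw [← natCast_log]
    ring
  have hδ : 0 < (s.re - 1) / 2 := by linarith
  have hO : (fun n : ℕ ↦ ∑ k ∈ Finset.Icc 1 n,
      ‖LSeries.logMul (LSeries.logMul fun n ↦ (vonMangoldt n : ℂ) - 1) k‖)
      =O[atTop] fun n ↦ (n : ℝ) ^ (1 + (s.re - 1) / 2) := by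
    refine IsBigO.of_bound (28 / ((s.re - 1) / 2) ^ 2) ?_
    filter_upwards [eventually_ge_atTop 1] with n hn
    have := sum_vonMangoldt_add_one_mul_log_sq_le_rpow hδ (x := n) (by exact_mod_cast hn)
    rw [Nat.floor_natCast] at this
    rw [Real.norm_of_nonneg (by positivity), Real.norm_of_nonneg (by positivity)]
    refine le_trans (Finset.sum_le_sum fun k _ ↦ ?_) this
    rw [hf, norm_real, Real.norm_eq_abs, abs_mul, abs_of_nonneg (sq_nonneg (Real.log k))]
    have := vonMangoldt_nonneg (n := k)
    gcongr
    rw [abs_le]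
    constructor <;> linarith
  rw [LSeries_eq_mul_integral' _ (by linarith) (by linarith) hO, mellin]
  congr 1
  rw [← integral_indicator measurableSet_Ioi, ← integral_indicator measurableSet_Ioi]
  congr 1
  ext t
  simp only [Set.indicator, Set.mem_Ioi]
  have hsum : ∑ k ∈ Finset.Icc 1 ⌊t⌋₊,
      LSeries.logMul (LSeries.logMul fun n ↦ (vonMangoldt n : ℂ) - 1) k = (logSqRemainder t : ℂ) := by
    rw [logSqRemainder]
    push_cast
    exact Finset.sum_congr rfl fun n _ ↦ by rw [hf]; push_cast; ring
  rw [hsum]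
  rcases lt_trichotomy t 1 with h | rfl | h
  · simp [logSqRemainder_of_lt_one h]
  · simp [logSqRemainder_one]
  · rw [if_pos h, if_pos (by linarith), smul_eq_mul, mul_comm, neg_add', sub_eq_add_neg]

lemma exists_integral_logSqRemainder_sq_le :
    ∃ C > 0, ∀ σ : ℝ, 1 < σ → σ ≤ 2 →
      Integrable (fun u : ℝ ↦ (Real.exp (-σ * u) * logSqRemainder (Real.exp u)) ^ 2) ∧
      ∫ u : ℝ, (Real.exp (-σ * u) * logSqRemainder (Real.exp u)) ^ 2 ≤ C := by
  obtain ⟨C, hC, hF⟩ := exists_norm_LSeries_logMul_logMul_le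
  set w : ℝ → ℝ := fun ξ ↦ 2 * C * (1 + ‖ξ‖) ^ (-(5 / 8) : ℝ) with hw
  have hwL : MemLp w 2 := by
    refine (memLp_two_iff_integrable_sq ?_).2 ?_
    · exact Measurable.aestronglyMeasurable (by fun_prop)
    · have := (integrable_one_add_norm (E := ℝ) (μ := volume) (r := 5 / 4)
        (by norm_num)).const_mul ((2 * C) ^ 2)
      refine this.congr (ae_of_all _ fun ξ ↦ ?_)
      have h0 : (0 : ℝ) ≤ 1 + ‖ξ‖ := by positivity
      simp only [hw]
      rw [mul_pow (2 * C) ((1 + ‖ξ‖) ^ (-(5 / 8) : ℝ)), ← Real.rpow_natCast ((1 + ‖ξ‖) ^ (-(5 / 8) : ℝ)), ← Real.rpow_mul h0]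
      norm_num
  refine ⟨(eLpNorm w 2).toReal ^ 2 + 1, by positivity, fun σ hσ hσ2 ↦ ?_⟩
  set δ := (σ - 1) / 2 with hδdef
  have hδ : 0 < δ := by rw [hδdef]; linarith
  set h : ℝ → ℂ := fun u ↦ Real.exp (σ * u) • (logSqRemainder (Real.exp (-u)) : ℂ) with hh
  have hmeas : Measurable h := by
    have := measurable_logSqRemainder
    fun_prop
  have hb : ∀ u, ‖h u‖ ≤ Set.indicator (Set.Iic 0) (fun u ↦ 28 / δ ^ 2 * Real.exp (δ * u)) u := by
    intro u
    simp only [hh, norm_smul, norm_real, Real.norm_eq_abs, Real.abs_exp, Set.indicator, Set.mem_Iic]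
    split_ifs with hu
    · have := abs_logSqRemainder_le_rpow hδ (Real.exp_pos (-u)).le
      calc _ ≤ Real.exp (σ * u) * (28 / δ ^ 2 * Real.exp (-u) ^ (1 + δ)) := by gcongr
        _ = 28 / δ ^ 2 * (Real.exp (σ * u) * Real.exp (-u * (1 + δ))) := by
            rw [← Real.exp_mul]; ring
        _ = _ := by
            rw [← Real.exp_add]
            congr 2
            rw [hδdef]; ring
    · rw [logSqRemainder_of_lt_one (by rw [Real.exp_lt_one_iff]; linarith)]
      simp
  have hfint : Integrable h :=
    Integrable.mono' (IntegrableOn.integrable_indicator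
      ((integrableOn_exp_mul_Iic hδ 0).const_mul _) measurableSet_Iic) hmeas.aestronglyMeasurable (ae_of_all _ hb)
  have hsqb : ∀ u, ‖h u‖ ^ 2 ≤
      Set.indicator (Set.Iic 0) (fun u ↦ (28 / δ ^ 2) ^ 2 * Real.exp ((2 * δ) * u)) u := by
    intro u
    refine (pow_le_pow_left₀ (norm_nonneg _) (hb u) 2).trans (le_of_eq ?_)
    simp only [Set.indicator]
    split_ifs
    · rw [mul_pow, ← Real.exp_nat_mul]; push_cast; ring_nf
    · simp
  have hsq : Integrable fun u ↦ ‖h u‖ ^ 2 :=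
    Integrable.mono' (IntegrableOn.integrable_indicator
      ((integrableOn_exp_mul_Iic (by positivity : 0 < 2 * δ) 0).const_mul _) measurableSet_Iic)
      (by fun_prop)
      (ae_of_all _ fun u ↦ by rw [Real.norm_of_nonneg (by positivity)]; exact hsqb u)
  have hL2 : MemLp h 2 := (memLp_two_iff_integrable_sq_norm hmeas.aestronglyMeasurable).2 hsq
  have hfour : ∀ ξ, ‖FourierTransform.fourier h ξ‖ ≤ w ξ := by
    intro ξ
    set s : ℂ := ⟨σ, -(2 * Real.pi * ξ)⟩ with hs
    have e1 := mellin_eq_fourier (fun t ↦ (logSqRemainder t : ℂ)) (s := -s)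
    have e2 : (-s).im / (2 * Real.pi) = ξ := by simp [hs]
    have e3 : (fun u : ℝ ↦ Real.exp (-(-s).re * u) • (logSqRemainder (Real.exp (-u)) : ℂ)) = h := by
      simp [hs, hh]
    rw [e2, e3] at e1
    have e4 := LSeries_eq_mul_mellin_logSqRemainder (s := s) hσ
    have e5 := hF s hσ hσ2
    rw [e4, norm_mul, e1] at e5
    have e6 : (1 + |s.im|) / 2 ≤ ‖s‖ := by
      have a1 := abs_re_le_norm s
      have a2 := abs_im_le_norm s
      have a3 : |s.re| = σ := abs_of_pos (by linarith)
      linarith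
    have e7 : 1 + ‖ξ‖ ≤ 1 + |s.im| := by
      have : |s.im| = 2 * Real.pi * |ξ| := by simp [hs, abs_mul, abs_of_pos Real.pi_pos]
      rw [this, Real.norm_eq_abs]
      nlinarith [Real.pi_gt_three, abs_nonneg ξ]
    have h0 : (0 : ℝ) < 1 + |s.im| := by positivity
    have h0' : (0 : ℝ) < 1 + ‖ξ‖ := by positivity
    have e8 : (1 + |s.im|) / 2 * ‖FourierTransform.fourier h ξ‖ ≤ C * (1 + |s.im|) ^ (3 / 8 : ℝ) :=
      (mul_le_mul_of_nonneg_right e6 (norm_nonneg _)).trans e5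
    have e9 : (1 + |s.im|) ^ (3 / 8 : ℝ) = (1 + |s.im|) * (1 + |s.im|) ^ (-(5 / 8) : ℝ) := by
      rw [← Real.rpow_one_add' h0.le (by norm_num)]; norm_num
    rw [e9] at e8
    have e10 : ‖FourierTransform.fourier h ξ‖ ≤ 2 * C * (1 + |s.im|) ^ (-(5 / 8) : ℝ) := by
      have : (1 + |s.im|) * ‖FourierTransform.fourier h ξ‖
        ≤ (1 + |s.im|) * (2 * C * (1 + |s.im|) ^ (-(5 / 8) : ℝ)) := by linarith
      exact le_of_mul_le_mul_left this h0
    refine e10.trans ?_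
    simp only [hw]
    gcongr 2 * C * ?_
    exact Real.rpow_le_rpow_of_nonpos h0' e7 (by norm_num)
  have hfc : Continuous (FourierTransform.fourier h) :=
    VectorFourier.fourierIntegral_continuous Real.continuous_fourierChar
      (by exact continuous_inner) hfint
  have hfL : MemLp (FourierTransform.fourier h) 2 :=
    MemLp.of_le hwL hfc.aestronglyMeasurable (ae_of_all _ fun ξ ↦
      (hfour ξ).trans (Real.le_norm_self _))
  have hle : eLpNorm h 2 ≤ eLpNorm w 2 :=
    (eLpNorm_le_eLpNorm_fourier hfint hL2 hfL).trans (eLpNorm_mono_ae_real (ae_of_all _ hfour))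
  have hval : ∫ u, ‖h u‖ ^ 2 ≤ (eLpNorm w 2).toReal ^ 2 := by
    have a := hL2.eLpNorm_eq_integral_rpow_norm (by norm_num) (by norm_num)
    have b := ENNReal.toReal_mono hwL.2.ne hle
    rw [a, ENNReal.toReal_ofReal (by positivity)] at b
    simp only [ENNReal.toReal_ofNat, Real.rpow_ofNat] at b
    have c := pow_le_pow_left₀ (by positivity) b 2
    rw [← Real.rpow_natCast, ← Real.rpow_mul (by positivity)] at c
    simpa using c
  have hrel : ∀ u, ‖h (-u)‖ ^ 2 = (Real.exp (-σ * u) * logSqRemainder (Real.exp u)) ^ 2 := by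
    intro u
    simp only [hh, norm_smul, norm_real, Real.norm_eq_abs, Real.abs_exp, mul_pow, sq_abs, neg_neg]
    ring_nf
  constructor
  · simpa only [hrel] using hsq.comp_neg
  · rw [← integral_congr_ae (ae_of_all _ hrel), integral_neg_eq_self (fun u ↦ ‖h u‖ ^ 2)]
    linarith

open ArithmeticFunction in
lemma logSqRemainder_sub_le {x y : ℝ} (hx : 1 ≤ x) (hxy : x ≤ y) :
    logSqRemainder x - (y - x + 1) * Real.log y ^ 2 ≤ logSqRemainder y := by
  have hf : ⌊x⌋₊ ≤ ⌊y⌋₊ := Nat.floor_mono hxy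
  have h1 : logSqRemainder y = logSqRemainder x +
      ∑ n ∈ Finset.Ioc ⌊x⌋₊ ⌊y⌋₊, (vonMangoldt n - 1) * Real.log n ^ 2 := by
    simp only [logSqRemainder]
    exact (Finset.sum_Ioc_consecutive (fun n : ℕ ↦ (vonMangoldt n - 1) * Real.log n ^ 2)
      (Nat.zero_le _) hf).symm
  have h2 : -(((⌊y⌋₊ : ℝ) - ⌊x⌋₊) * Real.log y ^ 2) ≤
      ∑ n ∈ Finset.Ioc ⌊x⌋₊ ⌊y⌋₊, (vonMangoldt n - 1) * Real.log n ^ 2 := by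
    have : -(((⌊y⌋₊ : ℝ) - ⌊x⌋₊) * Real.log y ^ 2) =
        ∑ n ∈ Finset.Ioc ⌊x⌋₊ ⌊y⌋₊, -(Real.log y ^ 2) := by
      rw [Finset.sum_const, Nat.card_Ioc, nsmul_eq_mul, Nat.cast_sub hf]
      ring
    rw [this]
    refine Finset.sum_le_sum fun n hn ↦ ?_
    obtain ⟨hn1, hn2⟩ := Finset.mem_Ioc.1 hn
    have h1n : (1 : ℝ) ≤ n := by exact_mod_cast (by omega : 1 ≤ n)
    have hny : (n : ℝ) ≤ y := (Nat.le_floor_iff (by linarith)).1 hn2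
    have hl0 := Real.log_nonneg h1n
    have hl : Real.log n ≤ Real.log y := Real.log_le_log (by linarith) hny
    have := vonMangoldt_nonneg (n := n)
    nlinarith [mul_nonneg this (sq_nonneg (Real.log n))]
  have h3 : (⌊y⌋₊ : ℝ) ≤ y := Nat.floor_le (by linarith)
  have h4 := Nat.lt_floor_add_one x
  have h5 : ((⌊y⌋₊ : ℝ) - ⌊x⌋₊) * Real.log y ^ 2 ≤ (y - x + 1) * Real.log y ^ 2 := by
    gcongr
    linarith
  linarith

/-- A lower bound for `logSqRemainder` on a window of relative length `1 / log x`, inserted in the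
mean square bound. -/
lemma log_le_of_le_abs_logSqRemainder {C x a : ℝ} (hx : 1 ≤ Real.log x) (hx0 : 0 < x)
    (hC : ∀ σ : ℝ, 1 < σ → σ ≤ 2 →
      Integrable (fun u : ℝ ↦ (Real.exp (-σ * u) * logSqRemainder (Real.exp u)) ^ 2) ∧
      ∫ u : ℝ, (Real.exp (-σ * u) * logSqRemainder (Real.exp u)) ^ 2 ≤ C)
    (ha : a ≤ Real.log x)
    (hB : ∀ u ∈ Set.Icc a (a + 1 / Real.log x),
      12 * x * Real.log x ≤ |logSqRemainder (Real.exp u)|) :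
    Real.log x ≤ C * Real.exp 6 := by
  set L := Real.log x with hL
  have hL0 : 0 < L := by linarith
  have hinv : 1 / L ≤ 1 := by rw [div_le_one hL0]; exact hx
  obtain ⟨hi, hle⟩ := hC (1 + 1 / L) (by simp [hL0]) (by linarith)
  have hexp : Real.exp L = x := Real.exp_log hx0
  have key : ∀ u ∈ Set.Icc a (a + 1 / L), (12 * L * Real.exp (-3)) ^ 2 ≤
      (Real.exp (-(1 + 1 / L) * u) * logSqRemainder (Real.exp u)) ^ 2 := by
    intro u hu
    have h1 := hB u hu
    have h2 : Real.exp (-L - 3) ≤ Real.exp (-(1 + 1 / L) * u) := by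
      apply Real.exp_le_exp.2
      have : u ≤ L + 1 / L := hu.2.trans (by linarith)
      have h3 : (1 + 1 / L) * u ≤ (1 + 1 / L) * (L + 1 / L) := by gcongr
      have h4 : (1 + 1 / L) * (L + 1 / L) = L + 1 + 1 / L + 1 / L * (1 / L) := by field_simp; ring
      have h5 : 1 / L * (1 / L) ≤ 1 := mul_le_one₀ hinv (by positivity) hinv
      linarith
    have h6 : Real.exp (-L - 3) * x = Real.exp (-3) := by
      calc Real.exp (-L - 3) * x = Real.exp (-L - 3) * Real.exp L := by rw [hexp]
        _ = Real.exp (-3) := by rw [← Real.exp_add]; congr 1; ring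
    rw [mul_pow (Real.exp (-(1 + 1 / L) * u)), ← sq_abs (logSqRemainder _), ← mul_pow]
    have h7 : 12 * L * Real.exp (-3) = Real.exp (-L - 3) * (12 * x * L) := by rw [← h6]; ring
    rw [h7]
    gcongr
  have h8 := setIntegral_ge_of_const_le_real (μ := volume) measurableSet_Icc
    (by simp) key hi.integrableOn
  have h9 := setIntegral_le_integral (s := Set.Icc a (a + 1 / L)) hi
    (ae_of_all _ fun u ↦ sq_nonneg _)
  rw [Real.volume_real_Icc_of_le (by linarith [one_div_pos.2 hL0])] at h8
  have h10 : (12 * L * Real.exp (-3)) ^ 2 * (a + 1 / L - a) = 144 * L * Real.exp (-6) := by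
    have : Real.exp (-3) ^ 2 = Real.exp (-6) := by rw [← Real.exp_nat_mul]; norm_num
    rw [mul_pow, this]
    field_simp
    ring
  rw [h10] at h8
  have h11 : 144 * L * Real.exp (-6) ≤ C := h8.trans (h9.trans hle)
  have h12 : Real.exp (-6) * Real.exp 6 = 1 := by rw [← Real.exp_add]; simp
  have h13 := mul_le_mul_of_nonneg_right h11 (Real.exp_pos 6).le
  rw [mul_assoc, h12] at h13
  linarith

lemma exists_abs_logSqRemainder_le_of_large :
    ∃ T ≥ 2, ∀ x ≥ T, |logSqRemainder x| ≤ 24 * x * Real.log x := by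
  obtain ⟨C, hC0, hC⟩ := exists_integral_logSqRemainder_sq_le
  refine ⟨Real.exp (max 1 (C * Real.exp 6) + 1), ?_, fun x hx ↦ ?_⟩
  · have := Real.add_one_le_exp (max 1 (C * Real.exp 6) + 1)
    have := le_max_left 1 (C * Real.exp 6)
    linarith
  have hx0 : 0 < x := (Real.exp_pos _).trans_le hx
  set L := Real.log x with hLdef
  have hLx : max 1 (C * Real.exp 6) + 1 ≤ L := (Real.le_log_iff_exp_le hx0).2 hx
  have hL1 : 2 ≤ L := by have := le_max_left 1 (C * Real.exp 6); linarith
  have hL2 : C * Real.exp 6 < L := by have := le_max_right 1 (C * Real.exp 6); linarith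
  have hL0 : 0 < L := by linarith
  have hinv : 1 / L ≤ 1 := by rw [div_le_one hL0]; linarith
  have hexp : Real.exp L = x := Real.exp_log hx0
  have hxL : L ≤ x := by have := Real.add_one_le_exp L; linarith
  have hone : 1 ≤ x / L := by rwa [one_le_div hL0]
  by_contra! hcon
  rcases le_total 0 (logSqRemainder x) with h | h
  · rw [abs_of_nonneg h] at hcon
    refine absurd (log_le_of_le_abs_logSqRemainder (a := L) (by linarith) hx0 hC le_rfl ?_)
      (not_le.2 hL2)
    intro u hu
    refine le_trans ?_ (le_abs_self _)
    have hxu : x ≤ Real.exp u := by rw [← hexp]; exact Real.exp_le_exp.2 hu.1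
    have hs := logSqRemainder_sub_le (by linarith) hxu
    rw [Real.log_exp] at hs
    have h1 : Real.exp u ≤ x + 2 * (x / L) := by
      have h2 : Real.exp u ≤ x * Real.exp (1 / L) := by
        calc Real.exp u ≤ Real.exp (L + 1 / L) := Real.exp_le_exp.2 hu.2
          _ = x * Real.exp (1 / L) := by rw [Real.exp_add, hexp]
      have h3 := Real.abs_exp_sub_one_le (x := 1 / L) (by rw [abs_of_pos (by positivity)]; exact hinv)
      rw [abs_of_pos (by positivity : 0 < 1 / L)] at h3
      have h4 := (abs_le.1 h3).2
      have h5 : x * Real.exp (1 / L) ≤ x * (1 + 2 * (1 / L)) := by gcongr; linarith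
      have h6 : x * (1 + 2 * (1 / L)) = x + 2 * (x / L) := by ring
      linarith
    have hu2 : u ≤ 2 * L := by have := hu.2; linarith
    have hu0 : 0 ≤ u := by have := hu.1; linarith
    have h7 : (Real.exp u - x + 1) * u ^ 2 ≤ (3 * (x / L)) * (2 * L) ^ 2 := by
      gcongr
      linarith
    have h8 : (3 * (x / L)) * (2 * L) ^ 2 = 12 * x * L := by field_simp; ring
    linarith
  · rw [abs_of_nonpos h] at hcon
    refine absurd (log_le_of_le_abs_logSqRemainder (a := L - 1 / L) (by linarith) hx0 hC
      (by have := one_div_pos.2 hL0; linarith) ?_) (not_le.2 hL2)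
    intro u hu
    refine le_trans ?_ (neg_le_abs _)
    have hu1 : u ≤ L := hu.2.trans (by rw [← hLdef]; linarith)
    have hux : Real.exp u ≤ x := by rw [← hexp]; exact Real.exp_le_exp.2 hu1
    have hu0 : 0 ≤ u := by have := hu.1; linarith
    have hs := logSqRemainder_sub_le (by rwa [Real.one_le_exp_iff]) hux
    rw [← hLdef] at hs
    have h1 : x - x / L ≤ Real.exp u := by
      have h2 : x * Real.exp (-(1 / L)) ≤ Real.exp u := by
        nth_rewrite 1 [← hexp]
        rw [← Real.exp_add]
        exact Real.exp_le_exp.2 (by linarith [hu.1])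
      have h3 := Real.add_one_le_exp (-(1 / L))
      have h5 : x * (-(1 / L) + 1) ≤ x * Real.exp (-(1 / L)) := by gcongr
      have h6 : x * (-(1 / L) + 1) = x - x / L := by ring
      linarith
    have h7 : (x - Real.exp u + 1) * L ^ 2 ≤ (2 * (x / L)) * L ^ 2 := by
      gcongr
      linarith
    have h8 : (2 * (x / L)) * L ^ 2 = 2 * x * L := by field_simp
    have h9 : 0 ≤ x * L := by positivity
    linarith

lemma exists_abs_logSqRemainder_le :
    ∃ M > 0, ∀ x ≥ 2, |logSqRemainder x| ≤ M * (x * Real.log x) := by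
  obtain ⟨T, hT, h⟩ := exists_abs_logSqRemainder_le_of_large
  have hl2 : 0 < Real.log 2 := Real.log_pos (by norm_num)
  refine ⟨24 + 28 * T / Real.log 2, by positivity, fun x hx ↦ ?_⟩
  have hlx : Real.log 2 ≤ Real.log x := Real.log_le_log (by norm_num) hx
  have hx0 : 0 < x := by linarith
  have hxl : 0 ≤ x * Real.log x := mul_nonneg hx0.le (by linarith)
  rcases le_total T x with hTx | hTx
  · have := h x hTx
    have : 0 ≤ 28 * T / Real.log 2 * (x * Real.log x) := by positivity
    linarith
  · have h1 := abs_logSqRemainder_le_rpow one_pos hx0.le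
    have h2 : x ^ (1 + 1 : ℝ) = x * x := by rw [Real.rpow_add hx0, Real.rpow_one]
    rw [h2] at h1
    have h3 : 28 * (T * x) ≤ 28 * T / Real.log 2 * (x * Real.log x) := by
      rw [div_mul_eq_mul_div, le_div_iff₀ hl2]
      have := mul_le_mul_of_nonneg_left hlx (by positivity : 0 ≤ 28 * (T * x))
      linarith
    have h4 : x * x ≤ T * x := by gcongr
    norm_num at h1
    linarith

lemma exists_log_le_mul_rpow {δ : ℝ} (hδ : 0 < δ) :
    ∃ K > 0, ∀ t y : ℝ, 2 ≤ t → t ≤ y → Real.log y ≤ K * Real.log t * (y / t) ^ δ := by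
  refine ⟨1 + 1 / (δ * Real.log 2), by have := Real.log_pos one_lt_two; positivity,
    fun t y ht hty ↦ ?_⟩
  have h2 := Real.log_pos one_lt_two
  have ht0 : 0 < t := by linarith
  have hlt : Real.log 2 ≤ Real.log t := Real.log_le_log two_pos ht
  have hyt : 1 ≤ y / t := by rwa [one_le_div ht0]
  have h1 : 1 ≤ (y / t) ^ δ := Real.one_le_rpow hyt hδ.le
  have h3 : Real.log (y / t) ≤ (y / t) ^ δ / δ := Real.log_le_rpow_div (by positivity) hδ
  have h4 : Real.log y = Real.log t + Real.log (y / t) := by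
    rw [Real.log_div (by linarith) ht0.ne']; ring
  have h5 : 1 ≤ Real.log t / Real.log 2 := by rwa [one_le_div h2]
  calc Real.log y ≤ Real.log t * 1 + (y / t) ^ δ / δ * 1 := by linarith
    _ ≤ Real.log t * (y / t) ^ δ + (y / t) ^ δ / δ * (Real.log t / Real.log 2) := by
        gcongr
        linarith
    _ = _ := by field_simp

lemma continuousOn_rpow_div_log_sq (s : ℝ) {a b : ℝ} (ha : 2 ≤ a) :
    ContinuousOn (fun t : ℝ ↦ t ^ s / Real.log t ^ 2) (Set.Icc a b) := by
  intro t ht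
  have ht2 : 2 ≤ t := ha.trans ht.1
  have : Real.log t ≠ 0 := (Real.log_pos (by linarith)).ne'
  have h0 : t ≠ 0 := by linarith
  refine ContinuousAt.continuousWithinAt ?_
  exact (Real.continuousAt_rpow_const t s (Or.inl h0)).div ((Real.continuousAt_log h0).pow 2)
    (pow_ne_zero 2 this)

lemma intervalIntegrable_rpow_div_log_sq (s : ℝ) {a b : ℝ} (ha : 2 ≤ a) (hab : a ≤ b) :
    IntervalIntegrable (fun t : ℝ ↦ t ^ s / Real.log t ^ 2) volume a b := by
  refine ContinuousOn.intervalIntegrable ?_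
  rw [Set.uIcc_of_le hab]
  exact continuousOn_rpow_div_log_sq s ha

lemma exists_integral_rpow_div_log_sq_le {s : ℝ} (hs : -1 < s) :
    ∃ K > 0, ∀ y : ℝ, 2 ≤ y →
      ∫ t in (2 : ℝ)..y, t ^ s / Real.log t ^ 2 ≤ K * (y ^ (s + 1) / Real.log y ^ 2) := by
  have hs' : 0 < s + 1 := by linarith
  obtain ⟨K, hK, h⟩ := exists_log_le_mul_rpow (δ := (s + 1) / 4) (by positivity)
  refine ⟨K ^ 2 / ((s + 1) / 2), by positivity, fun y hy ↦ ?_⟩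
  have hy0 : 0 < y := by linarith
  have hly : 0 < Real.log y := Real.log_pos (by linarith)
  have hi : IntervalIntegrable (fun t : ℝ ↦ K ^ 2 * y ^ ((s + 1) / 2) / Real.log y ^ 2 *
      t ^ (s - (s + 1) / 2)) volume 2 y :=
    (intervalIntegral.intervalIntegrable_rpow' (by linarith)).const_mul _
  refine (intervalIntegral.integral_mono_on hy (intervalIntegrable_rpow_div_log_sq s le_rfl hy)
    hi ?_).trans ?_
  · intro t ht
    have ht0 : 0 < t := by linarith [ht.1]
    have hlt : 0 < Real.log t := Real.log_pos (by linarith [ht.1])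
    have h1 := pow_le_pow_left₀ hly.le (h t y ht.1 ht.2) 2
    have h2 : ((y / t) ^ ((s + 1) / 4)) ^ 2 = y ^ ((s + 1) / 2) / t ^ ((s + 1) / 2) := by
      rw [← Real.div_rpow hy0.le ht0.le, ← Real.rpow_natCast, ← Real.rpow_mul (by positivity)]
      congr 1
      push_cast
      ring
    rw [mul_pow, mul_pow, h2] at h1
    rw [Real.rpow_sub ht0, div_mul_eq_mul_div, div_le_div_iff₀ (by positivity) (by positivity)]
    calc t ^ s * Real.log y ^ 2
        ≤ t ^ s * (K ^ 2 * Real.log t ^ 2 * (y ^ ((s + 1) / 2) / t ^ ((s + 1) / 2))) := by gcongr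
      _ = _ := by ring
  · rw [intervalIntegral.integral_const_mul, integral_rpow (Or.inl (by linarith))]
    have h3 : s - (s + 1) / 2 + 1 = (s + 1) / 2 := by ring
    have h4 : y ^ (s + 1) = y ^ ((s + 1) / 2) * y ^ ((s + 1) / 2) := by
      rw [← Real.rpow_add hy0]; congr 1; ring
    rw [h3, h4]
    have h5 : y ^ ((s + 1) / 2) - 2 ^ ((s + 1) / 2) ≤ y ^ ((s + 1) / 2) := by
      have : (0:ℝ) ≤ 2 ^ ((s + 1) / 2) := by positivity
      linarith
    calc _ ≤ K ^ 2 * y ^ ((s + 1) / 2) / Real.log y ^ 2 * (y ^ ((s + 1) / 2) / ((s + 1) / 2)) := by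
          gcongr
      _ = _ := by ring

lemma integral_rpow_div_log_sq_le {s : ℝ} (hs : s < -1) {a b : ℝ} (ha : 2 ≤ a) (hab : a ≤ b) :
    ∫ t in a..b, t ^ s / Real.log t ^ 2 ≤ 1 / (-(s + 1)) * (a ^ (s + 1) / Real.log a ^ 2) := by
  have hs' : 0 < -(s + 1) := by linarith
  have ha0 : 0 < a := by linarith
  have hla : 0 < Real.log a := Real.log_pos (by linarith)
  have h0 : (0 : ℝ) ∉ Set.uIcc a b := by
    rw [Set.uIcc_of_le hab]
    exact fun h ↦ by linarith [h.1]
  have hi : IntervalIntegrable (fun t : ℝ ↦ 1 / Real.log a ^ 2 * t ^ s) volume a b :=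
    (intervalIntegral.intervalIntegrable_rpow (Or.inr h0)).const_mul _
  refine (intervalIntegral.integral_mono_on hab (intervalIntegrable_rpow_div_log_sq s ha hab)
    hi ?_).trans ?_
  · intro t ht
    have ht0 : 0 < t := by linarith [ht.1]
    have : Real.log a ≤ Real.log t := Real.log_le_log ha0 ht.1
    rw [div_eq_mul_one_div, mul_comm]
    gcongr
  · rw [intervalIntegral.integral_const_mul, integral_rpow (Or.inr ⟨by linarith, h0⟩)]
    have hb : 0 ≤ b ^ (s + 1) := Real.rpow_nonneg (by linarith) _
    have h5 : (b ^ (s + 1) - a ^ (s + 1)) / (s + 1) ≤ a ^ (s + 1) / (-(s + 1)) := by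
      rw [← neg_div_neg_eq]
      gcongr
      linarith
    calc _ ≤ 1 / Real.log a ^ 2 * (a ^ (s + 1) / (-(s + 1))) := by gcongr
      _ = _ := by ring

lemma hasDerivAt_one_div_log_sq {t : ℝ} (ht : 2 ≤ t) :
    HasDerivAt (fun t : ℝ ↦ 1 / Real.log t ^ 2) (-2 / (t * Real.log t ^ 3)) t := by
  have h0 : t ≠ 0 := by linarith
  have hl : Real.log t ≠ 0 := (Real.log_pos (by linarith)).ne'
  refine ((hasDerivAt_const t (1 : ℝ)).div ((Real.hasDerivAt_log h0).pow 2)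
    (pow_ne_zero 2 hl)).congr_deriv ?_
  simp only [Pi.pow_apply]
  field_simp
  norm_num
  ring

lemma exists_abs_psi_sub_le :
    ∃ C > 0, ∀ x ≥ 2, |Chebyshev.psi x - x| ≤ C * (x / Real.log x) := by
  obtain ⟨M, hM, hR⟩ := exists_abs_logSqRemainder_le
  obtain ⟨K, hK, hJ⟩ := exists_integral_rpow_div_log_sq_le (s := 0) (by norm_num)
  refine ⟨M + 2 * M * K / Real.log 2 + 2, by have := Real.log_pos one_lt_two; positivity,
    fun x hx ↦ ?_⟩
  have hx0 : 0 < x := by linarith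
  have hl2 := Real.log_pos one_lt_two
  have hl : Real.log 2 ≤ Real.log x := Real.log_le_log two_pos hx
  have hl0 : 0 < Real.log x := hl2.trans_le hl
  let c : ℕ → ℝ := fun n ↦ (ArithmeticFunction.vonMangoldt n - 1) * Real.log n ^ 2
  have hc0 : c 0 = 0 := by simp [c]
  have hc1 : c 1 = 0 := by simp [c]
  have hcR (t : ℝ) : ∑ k ∈ Finset.Icc 0 ⌊t⌋₊, c k = logSqRemainder t := by
    rw [logSqRemainder, ← Finset.insert_Icc_add_one_left_eq_Icc (Nat.zero_le _),
      Finset.sum_insert (by simp), hc0, zero_add]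
    rfl
  have hderiv : ∀ t ∈ Set.Icc 2 x, deriv (fun t : ℝ ↦ 1 / Real.log t ^ 2) t =
      -2 / (t * Real.log t ^ 3) := fun t ht ↦ (hasDerivAt_one_div_log_sq ht.1).deriv
  have hcont : ContinuousOn (fun t : ℝ ↦ -2 / (t * Real.log t ^ 3)) (Set.Icc 2 x) := by
    intro t ht
    have h0 : t ≠ 0 := by linarith [ht.1]
    have hlt : Real.log t ≠ 0 := (Real.log_pos (by linarith [ht.1])).ne'
    exact (continuousAt_const.div (continuousAt_id.mul ((Real.continuousAt_log h0).pow 3))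
      (mul_ne_zero h0 (pow_ne_zero 3 hlt))).continuousWithinAt
  have habel := sum_mul_eq_sub_integral_mul₁ c hc0 hc1 (f := fun t : ℝ ↦ 1 / Real.log t ^ 2) x
    (fun t ht ↦ (hasDerivAt_one_div_log_sq ht.1).differentiableAt)
    ((hcont.integrableOn_Icc).congr_fun (fun t ht ↦ (hderiv t ht).symm) measurableSet_Icc)
  simp only [hcR] at habel
  have hsum : ∑ k ∈ Finset.Icc 0 ⌊x⌋₊, 1 / Real.log k ^ 2 * c k =
      Chebyshev.psi x - (⌊x⌋₊ - 1) := by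
    have h2 : 2 ≤ ⌊x⌋₊ := Nat.le_floor (by exact_mod_cast hx)
    have hsub : Finset.Icc 2 ⌊x⌋₊ ⊆ Finset.Icc 0 ⌊x⌋₊ := Finset.Icc_subset_Icc (by norm_num) le_rfl
    have hsmall : ∀ n ∈ Finset.Icc 0 ⌊x⌋₊, n ∉ Finset.Icc 2 ⌊x⌋₊ → n = 0 ∨ n = 1 := by
      intro n hn hn'
      simp only [Finset.mem_Icc] at hn hn'
      omega
    rw [Chebyshev.psi_eq_sum_Icc, ← Finset.sum_subset hsub, ← Finset.sum_subset hsub]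
    · have h3 : ∑ n ∈ Finset.Icc 2 ⌊x⌋₊, (1 : ℝ) = ⌊x⌋₊ - 1 := by
        rw [Finset.sum_const, Nat.card_Icc, nsmul_eq_mul, mul_one, Nat.cast_sub (by omega)]
        push_cast
        ring
      rw [← h3, ← Finset.sum_sub_distrib]
      refine Finset.sum_congr rfl fun n hn ↦ ?_
      have hn2 : 2 ≤ n := (Finset.mem_Icc.1 hn).1
      have : Real.log n ≠ 0 := (Real.log_pos (by exact_mod_cast hn2)).ne'
      simp only [c]
      field_simp
    · intro n hn hn'
      rcases hsmall n hn hn' with rfl | rfl <;> simp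
    · intro n hn hn'
      rcases hsmall n hn hn' with rfl | rfl <;> simp
  rw [hsum] at habel
  have hfint : |∫ t in Set.Ioc 2 x, deriv (fun t : ℝ ↦ 1 / Real.log t ^ 2) t * logSqRemainder t| ≤
      2 * M * (K * (x / Real.log x ^ 2)) := by
    have hJx := hJ x hx
    simp only [zero_add, Real.rpow_one] at hJx
    rw [intervalIntegral.integral_of_le hx] at hJx
    have hmaj : IntegrableOn (fun t : ℝ ↦ 2 * M * (t ^ (0 : ℝ) / Real.log t ^ 2)) (Set.Ioc 2 x) :=
      ((intervalIntegrable_rpow_div_log_sq 0 le_rfl hx).1).const_mul _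
    rw [← Real.norm_eq_abs]
    refine (norm_integral_le_of_norm_le hmaj ?_).trans ?_
    · refine (ae_restrict_iff' measurableSet_Ioc).2 (ae_of_all _ fun t ht ↦ ?_)
      have ht2 : 2 ≤ t := ht.1.le
      have ht0 : 0 < t := by linarith
      have hlt : 0 < Real.log t := Real.log_pos (by linarith)
      rw [hderiv t ⟨ht2, ht.2⟩, norm_mul, Real.norm_eq_abs, Real.norm_eq_abs, abs_div, abs_neg,
        abs_two, abs_of_pos (by positivity : 0 < t * Real.log t ^ 3), Real.rpow_zero]
      calc 2 / (t * Real.log t ^ 3) * |logSqRemainder t|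
          ≤ 2 / (t * Real.log t ^ 3) * (M * (t * Real.log t)) := by gcongr; exact hR t ht2
        _ = _ := by field_simp
    · rw [integral_const_mul]
      gcongr
  have hb : |1 / Real.log x ^ 2 * logSqRemainder x| ≤ M * (x / Real.log x) := by
    rw [abs_mul, abs_of_pos (by positivity)]
    calc _ ≤ 1 / Real.log x ^ 2 * (M * (x * Real.log x)) := by gcongr; exact hR x hx
      _ = _ := by field_simp
  have hf1 := Nat.floor_le hx0.le
  have hf2 := Nat.lt_floor_add_one x
  have hone : 1 ≤ x / Real.log x := by
    rw [one_le_div hl0]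
    linarith [Real.log_le_sub_one_of_pos hx0]
  have hK2 : 2 * M * (K * (x / Real.log x ^ 2)) ≤ 2 * M * K / Real.log 2 * (x / Real.log x) := by
    calc _ = 2 * M * K / Real.log x * (x / Real.log x) := by field_simp
      _ ≤ _ := by gcongr
  have e : Chebyshev.psi x - x = (Chebyshev.psi x - (⌊x⌋₊ - 1)) + (⌊x⌋₊ - x) - 1 := by ring
  rw [e, habel, abs_le]
  constructor <;> nlinarith [abs_le.1 hb, abs_le.1 hfint]

/-- The prime number theorem with a logarithmic saving in the error term. -/
theorem exists_abs_theta_sub_le :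
    ∃ C > 0, ∀ x ≥ 2, |Chebyshev.theta x - x| ≤ C * (x / Real.log x) := by
  obtain ⟨C, hC, h⟩ := exists_abs_psi_sub_le
  refine ⟨C + 128, by positivity, fun x hx ↦ ?_⟩
  have hx0 : 0 < x := by linarith
  have hl0 : 0 < Real.log x := Real.log_pos (by linarith)
  have h1 := h x hx
  have h2 := Chebyshev.abs_psi_sub_theta_le_sqrt_mul_log (by linarith : 1 ≤ x)
  have h3 : Real.log x ≤ x ^ (1 / 8 : ℝ) / (1 / 8) := Real.log_le_rpow_div hx0.le (by norm_num)
  have h4 : 2 * √x * Real.log x ≤ 128 * (x / Real.log x) := by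
    rw [mul_div_assoc', le_div_iff₀ hl0]
    calc 2 * √x * Real.log x * Real.log x
        ≤ 2 * x ^ (1 / 2 : ℝ) * (x ^ (1 / 8 : ℝ) / (1 / 8)) * (x ^ (1 / 8 : ℝ) / (1 / 8)) := by
          rw [Real.sqrt_eq_rpow]; gcongr
      _ = 128 * (x ^ (1 / 2 : ℝ) * x ^ (1 / 8 : ℝ) * x ^ (1 / 8 : ℝ)) := by ring
      _ = 128 * x ^ (3 / 4 : ℝ) := by
          rw [← Real.rpow_add hx0, ← Real.rpow_add hx0]; norm_num
      _ ≤ 128 * x ^ (1 : ℝ) := by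
          gcongr
          · linarith
          · norm_num
      _ = 128 * x := by rw [Real.rpow_one]
  have e : Chebyshev.theta x - x = (Chebyshev.psi x - x) -
    (Chebyshev.psi x - Chebyshev.theta x) := by ring
  rw [e]
  refine (abs_sub _ _).trans ?_
  linarith

lemma hasDerivAt_rpow_div_log (s : ℝ) {t : ℝ} (ht : 2 ≤ t) :
    HasDerivAt (fun t : ℝ ↦ t ^ s / Real.log t)
      (s * t ^ (s - 1) / Real.log t - t ^ (s - 1) / Real.log t ^ 2) t := by
  have h0 : 0 < t := by linarith
  have hl : Real.log t ≠ 0 := (Real.log_pos (by linarith)).ne'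
  refine ((Real.hasDerivAt_rpow_const (p := s) (Or.inl h0.ne')).div
    (Real.hasDerivAt_log h0.ne') hl).congr_deriv ?_
  rw [Real.rpow_sub_one h0.ne']
  field_simp

lemma continuousOn_deriv_rpow_div_log (s : ℝ) {a b : ℝ} (ha : 2 ≤ a) :
    ContinuousOn (fun t : ℝ ↦ s * t ^ (s - 1) / Real.log t - t ^ (s - 1) / Real.log t ^ 2)
      (Set.Icc a b) := by
  intro t ht
  have ht2 : 2 ≤ t := ha.trans ht.1
  have h0 : t ≠ 0 := by linarith
  have hl : Real.log t ≠ 0 := (Real.log_pos (by linarith)).ne'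
  have h1 := Real.continuousAt_rpow_const t (s - 1) (Or.inl h0)
  have h2 := Real.continuousAt_log h0
  exact (((continuousAt_const.mul h1).div h2 hl).sub
    (h1.div (h2.pow 2) (pow_ne_zero 2 hl))).continuousWithinAt

/-- Partial summation from the prime number theorem for the sums `∑ p ^ s`. -/
theorem exists_abs_sum_prime_rpow_sub_le {s : ℝ} (hs : s ≠ -1) :
    ∃ K > 0, ∀ a b : ℝ, 2 ≤ a → a ≤ b →
      |∑ p ∈ Finset.Ioc ⌊a⌋₊ ⌊b⌋₊ with p.Prime, (p : ℝ) ^ s -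
        (b ^ (s + 1) / ((s + 1) * Real.log b) - a ^ (s + 1) / ((s + 1) * Real.log a))| ≤
      K * (b ^ (s + 1) / Real.log b ^ 2 + a ^ (s + 1) / Real.log a ^ 2 +
        ∫ t in a..b, t ^ s / Real.log t ^ 2) := by
  have hs' : s + 1 ≠ 0 := fun h ↦ hs (by linarith)
  obtain ⟨C, hC, hE⟩ := exists_abs_theta_sub_le
  have hl2 := Real.log_pos one_lt_two
  set K₁ := 1 / |s + 1| + (|s| + 1 / Real.log 2) * C with hK₁
  have hK₁0 : 0 < K₁ := by
    have : 0 < |s + 1| := abs_pos.2 hs'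
    positivity
  refine ⟨C + K₁, by positivity, fun a b ha hab ↦ ?_⟩
  have ha0 : 0 < a := by linarith
  have hb0 : 0 < b := by linarith
  have hla : 0 < Real.log a := Real.log_pos (by linarith)
  have hlb : 0 < Real.log b := Real.log_pos (by linarith)
  let c : ℕ → ℝ := fun n ↦ if n.Prime then Real.log n else 0
  let f : ℝ → ℝ := fun t ↦ t ^ s / Real.log t
  let f' : ℝ → ℝ := fun t ↦ s * t ^ (s - 1) / Real.log t - t ^ (s - 1) / Real.log t ^ 2
  have hcθ (t : ℝ) : ∑ k ∈ Finset.Icc 0 ⌊t⌋₊, c k = Chebyshev.theta t := by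
    rw [Chebyshev.theta_eq_sum_Icc, Finset.sum_filter]
  have hff' : ∀ t ∈ Set.Icc a b, HasDerivAt f (f' t) t :=
    fun t ht ↦ hasDerivAt_rpow_div_log s (ha.trans ht.1)
  have hcont : ContinuousOn f' (Set.Icc a b) := continuousOn_deriv_rpow_div_log s ha
  have hfint : IntegrableOn f' (Set.Icc a b) := hcont.integrableOn_Icc
  have habel := sum_mul_eq_sub_sub_integral_mul c ha0.le hab (f := f)
    (fun t ht ↦ (hff' t ht).differentiableAt)
    (hfint.congr_fun (fun t ht ↦ (hff' t ht).deriv.symm) measurableSet_Icc)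
  simp only [hcθ] at habel
  have hsum : ∑ k ∈ Finset.Ioc ⌊a⌋₊ ⌊b⌋₊, f k * c k =
      ∑ p ∈ Finset.Ioc ⌊a⌋₊ ⌊b⌋₊ with p.Prime, (p : ℝ) ^ s := by
    rw [Finset.sum_filter]
    refine Finset.sum_congr rfl fun n _ ↦ ?_
    simp only [f, c]
    split_ifs with hn
    · have : Real.log n ≠ 0 := (Real.log_pos (by exact_mod_cast hn.one_lt)).ne'
      field_simp
    · simp
  have hfint2 : IntegrableOn (fun t ↦ f' t * Chebyshev.theta t) (Set.Ioc a b) := by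
    have := integrableOn_mul_sum_Icc c (m := 0) ha0.le hfint
    simp only [hcθ] at this
    exact this.mono_set Set.Ioc_subset_Icc_self
  have hderiv : ∫ t in Set.Ioc a b, deriv f t * Chebyshev.theta t =
      ∫ t in a..b, f' t * Chebyshev.theta t := by
    rw [intervalIntegral.integral_of_le hab]
    refine setIntegral_congr_fun measurableSet_Ioc fun t ht ↦ ?_
    simp only [(hff' t ⟨ht.1.le, ht.2⟩).deriv]
  let g : ℝ → ℝ := fun t ↦ t * f' t + 1 / (s + 1) * (t ^ s / Real.log t ^ 2)
  have hI := intervalIntegrable_rpow_div_log_sq s ha hab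
  have hgcont : ContinuousOn g (Set.uIcc a b) := by
    rw [Set.uIcc_of_le hab]
    exact (continuousOn_id.mul hcont).add
      (continuousOn_const.mul (continuousOn_rpow_div_log_sq s ha))
  have hFTC : ∫ t in a..b, g t = s / (s + 1) * (b ^ (s + 1) / Real.log b) -
      s / (s + 1) * (a ^ (s + 1) / Real.log a) := by
    refine intervalIntegral.integral_eq_sub_of_hasDerivAt
      (f := fun t : ℝ ↦ s / (s + 1) * (t ^ (s + 1) / Real.log t)) (fun t ht ↦ ?_)
      hgcont.intervalIntegrable
    rw [Set.uIcc_of_le hab] at ht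
    have ht2 := ha.trans ht.1
    have ht0 : 0 < t := by linarith
    have hlt : Real.log t ≠ 0 := (Real.log_pos (by linarith)).ne'
    refine ((hasDerivAt_rpow_div_log (s + 1) ht2).const_mul (s / (s + 1))).congr_deriv ?_
    simp only [g, f']
    rw [add_sub_cancel_right, Real.rpow_sub_one ht0.ne']
    field_simp
    ring
  have hfb (t : ℝ) (ht : 2 ≤ t) : |f t * (Chebyshev.theta t - t)| ≤
      C * (t ^ (s + 1) / Real.log t ^ 2) := by
    have ht0 : 0 < t := by linarith
    have hlt : 0 < Real.log t := Real.log_pos (by linarith)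
    have hf0 : 0 ≤ f t := by positivity
    rw [abs_mul, abs_of_nonneg hf0]
    calc f t * |Chebyshev.theta t - t| ≤ f t * (C * (t / Real.log t)) := by
          gcongr; exact hE t ht
      _ = _ := by rw [Real.rpow_add_one ht0.ne']; simp only [f]; field_simp
  have hbound : |∫ t in a..b, (g t - f' t * Chebyshev.theta t)| ≤
      K₁ * ∫ t in a..b, t ^ s / Real.log t ^ 2 := by
    rw [← intervalIntegral.integral_const_mul, ← Real.norm_eq_abs]
    refine intervalIntegral.norm_integral_le_of_norm_le hab (ae_of_all _ fun t ht ↦ ?_)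
      (hI.const_mul _)
    have ht2 : 2 ≤ t := ha.trans ht.1.le
    have ht0 : 0 < t := by linarith
    have hlt : 0 < Real.log t := Real.log_pos (by linarith)
    have hlt2 : Real.log 2 ≤ Real.log t := Real.log_le_log two_pos ht2
    have e : g t - f' t * Chebyshev.theta t = 1 / (s + 1) * (t ^ s / Real.log t ^ 2) -
        f' t * (Chebyshev.theta t - t) := by simp only [g]; ring
    have hf'b : |f' t| ≤ (|s| + 1 / Real.log 2) * (t ^ (s - 1) / Real.log t) := by
      have e2 : f' t = (s - 1 / Real.log t) * (t ^ (s - 1) / Real.log t) := by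
        simp only [f']; field_simp
      rw [e2, abs_mul, abs_of_pos (by positivity : 0 < t ^ (s - 1) / Real.log t)]
      gcongr
      refine (abs_sub _ _).trans ?_
      rw [abs_of_pos (by positivity : 0 < 1 / Real.log t)]
      gcongr
    rw [e, Real.norm_eq_abs]
    refine (abs_sub _ _).trans ?_
    rw [abs_mul, abs_mul, abs_div, abs_one,
      abs_of_pos (by positivity : 0 < t ^ s / Real.log t ^ 2), hK₁, add_mul]
    refine add_le_add le_rfl ?_
    calc |f' t| * |Chebyshev.theta t - t|
        ≤ ((|s| + 1 / Real.log 2) * (t ^ (s - 1) / Real.log t)) * (C * (t / Real.log t)) := by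
          gcongr; exact hE t ht2
      _ = _ := by rw [Real.rpow_sub_one ht0.ne']; field_simp
  have hfint3 : IntervalIntegrable (fun t ↦ f' t * Chebyshev.theta t) volume a b := by
    rwa [intervalIntegrable_iff_integrableOn_Ioc_of_le hab]
  rw [intervalIntegral.integral_sub hgcont.intervalIntegrable hfint3, hFTC] at hbound
  rw [hsum, hderiv] at habel
  rw [habel]
  have ea : f a * a = a ^ (s + 1) / Real.log a := by
    simp only [f]; rw [Real.rpow_add_one ha0.ne']; ring
  have eb : f b * b = b ^ (s + 1) / Real.log b := by
    simp only [f]; rw [Real.rpow_add_one hb0.ne']; ring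
  have hJ0 : 0 ≤ ∫ t in a..b, t ^ s / Real.log t ^ 2 :=
    intervalIntegral.integral_nonneg hab fun t ht ↦ by
      have : 0 < t := by linarith [ht.1]
      positivity
  have e : f b * Chebyshev.theta b - f a * Chebyshev.theta a -
      (∫ t in a..b, f' t * Chebyshev.theta t) -
        (b ^ (s + 1) / ((s + 1) * Real.log b) - a ^ (s + 1) / ((s + 1) * Real.log a)) =
      f b * (Chebyshev.theta b - b) - f a * (Chebyshev.theta a - a) +
      (s / (s + 1) * (b ^ (s + 1) / Real.log b) - s / (s + 1) * (a ^ (s + 1) / Real.log a) -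
        ∫ t in a..b, f' t * Chebyshev.theta t) := by
    rw [mul_sub, mul_sub, ea, eb]
    field_simp
    ring
  rw [e]
  have h1 := hfb a ha
  have h2 := hfb b (ha.trans hab)
  have hA : 0 ≤ a ^ (s + 1) / Real.log a ^ 2 := by positivity
  have hB : 0 ≤ b ^ (s + 1) / Real.log b ^ 2 := by positivity
  refine (abs_add_le _ _).trans ((add_le_add (abs_sub _ _) hbound).trans ?_)
  nlinarith [mul_nonneg hK₁0.le hA, mul_nonneg hK₁0.le hB, mul_nonneg hC.le hJ0]

/-- The sum of the `α`-th powers of the primes up to `y`. -/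
noncomputable def sumPrimeRpow (α y : ℝ) : ℝ :=
  ∑ p ∈ (Finset.Icc 2 ⌊y⌋₊).filter Nat.Prime, (p : ℝ) ^ α

lemma log_sq_le_four_mul {y : ℝ} (hy : 1 ≤ y) : Real.log y ^ 2 ≤ 4 * y := by
  have h0 : 0 ≤ y := by linarith
  have h1 : Real.log y ≤ y ^ (1 / 2 : ℝ) / (1 / 2) := Real.log_le_rpow_div h0 (by norm_num)
  rw [← Real.sqrt_eq_rpow] at h1
  calc Real.log y ^ 2 ≤ (√y / (1 / 2)) ^ 2 := pow_le_pow_left₀ (Real.log_nonneg hy) h1 2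
    _ = 4 * y := by rw [div_pow, Real.sq_sqrt h0]; ring

lemma exists_abs_sumPrimeRpow_sub_le {α : ℝ} (hα : 0 < α) :
    ∃ K > 0, ∀ y : ℝ, 2 ≤ y →
      |sumPrimeRpow α y - y ^ (α + 1) / ((α + 1) * Real.log y)| ≤
        K * (y ^ (α + 1) / Real.log y ^ 2) := by
  obtain ⟨K, hK, h⟩ := exists_abs_sum_prime_rpow_sub_le (s := α) (by linarith)
  obtain ⟨K', hK', hJ⟩ := exists_integral_rpow_div_log_sq_le (s := α) (by linarith)
  have hl2 := Real.log_pos one_lt_two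
  set B : ℝ := 2 ^ α + 2 ^ (α + 1) / ((α + 1) * Real.log 2) +
    K * (2 ^ (α + 1) / Real.log 2 ^ 2) with hB
  have hB0 : 0 < B := by positivity
  refine ⟨K + K * K' + 4 * B, by positivity, fun y hy ↦ ?_⟩
  have hy0 : 0 < y := by linarith
  have hly : 0 < Real.log y := Real.log_pos (by linarith)
  have h1 := h 2 y le_rfl hy
  have h2 := hJ y hy
  have hsum : sumPrimeRpow α y =
      2 ^ α + ∑ p ∈ Finset.Ioc ⌊(2 : ℝ)⌋₊ ⌊y⌋₊ with p.Prime, (p : ℝ) ^ α := by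
    have hfl : 2 ≤ ⌊y⌋₊ := Nat.le_floor (by exact_mod_cast hy)
    rw [sumPrimeRpow, Nat.floor_ofNat, ← Finset.insert_Icc_add_one_left_eq_Icc hfl,
      Finset.filter_insert, if_pos Nat.prime_two, Finset.sum_insert (by simp)]
    norm_num
    rfl
  have h3 : 1 ≤ 4 * (y ^ (α + 1) / Real.log y ^ 2) := by
    rw [mul_div_assoc', one_le_div (by positivity)]
    refine (log_sq_le_four_mul (by linarith)).trans ?_
    gcongr
    exact Real.self_le_rpow_of_one_le (by linarith) (by linarith)
  have h4 : B ≤ 4 * B * (y ^ (α + 1) / Real.log y ^ 2) := by nlinarith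
  have e : sumPrimeRpow α y - y ^ (α + 1) / ((α + 1) * Real.log y) =
      (∑ p ∈ Finset.Ioc ⌊(2 : ℝ)⌋₊ ⌊y⌋₊ with p.Prime, (p : ℝ) ^ α -
        (y ^ (α + 1) / ((α + 1) * Real.log y) - 2 ^ (α + 1) / ((α + 1) * Real.log 2))) +
      (2 ^ α - 2 ^ (α + 1) / ((α + 1) * Real.log 2)) := by rw [hsum]; ring
  have h5 : |(2 : ℝ) ^ α - 2 ^ (α + 1) / ((α + 1) * Real.log 2)| ≤
      2 ^ α + 2 ^ (α + 1) / ((α + 1) * Real.log 2) := by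
    refine (abs_sub _ _).trans ?_
    rw [abs_of_pos (by positivity), abs_of_pos (by positivity)]
  rw [e]
  refine (abs_add_le _ _).trans ((add_le_add h1 h5).trans ?_)
  have h6 := mul_le_mul_of_nonneg_left h2 hK.le
  linarith

lemma exists_abs_sum_prime_rpow_neg_sub_le {β : ℝ} (hβ : 0 < β) :
    ∃ K > 0, ∀ a b : ℝ, 2 ≤ a → a ≤ b →
      |∑ p ∈ Finset.Ioc ⌊a⌋₊ ⌊b⌋₊ with p.Prime, (p : ℝ) ^ (-1 - β) -
        (a ^ (-β) / (β * Real.log a) - b ^ (-β) / (β * Real.log b))| ≤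
      K * (a ^ (-β) / Real.log a ^ 2) := by
  obtain ⟨K, hK, h⟩ := exists_abs_sum_prime_rpow_sub_le (s := -1 - β) (by linarith)
  refine ⟨K * (2 + 1 / β), by positivity, fun a b ha hab ↦ ?_⟩
  have h1 := h a b ha hab
  have h2 := integral_rpow_div_log_sq_le (s := -1 - β) (by linarith) ha hab
  have ha0 : 0 < a := by linarith
  have hla : 0 < Real.log a := Real.log_pos (by linarith)
  have e1 : -1 - β + 1 = -β := by ring
  rw [e1, neg_neg] at h2
  rw [e1] at h1
  have e2 : b ^ (-β) / (-β * Real.log b) - a ^ (-β) / (-β * Real.log a) =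
      a ^ (-β) / (β * Real.log a) - b ^ (-β) / (β * Real.log b) := by
    rw [neg_mul, neg_mul, div_neg, div_neg]
    ring
  rw [e2] at h1
  refine h1.trans ?_
  have h3 : b ^ (-β) / Real.log b ^ 2 ≤ a ^ (-β) / Real.log a ^ 2 := by
    have h4 : b ^ (-β) ≤ a ^ (-β) := Real.rpow_le_rpow_of_nonpos ha0 hab (by linarith)
    have h5 : Real.log a ≤ Real.log b := Real.log_le_log ha0 hab
    gcongr
  rw [mul_assoc]
  gcongr
  linarith

lemma exists_abs_sum_prime_rpow_neg_sub_le_of_long {β : ℝ} (hβ : 0 < β) :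
    ∃ K > 0, ∀ a b : ℝ, 2 ≤ a → a ≤ b → Real.log a ≤ (b / a) ^ β →
      |∑ p ∈ Finset.Ioc ⌊a⌋₊ ⌊b⌋₊ with p.Prime, (p : ℝ) ^ (-1 - β) -
        a ^ (-β) / (β * Real.log a)| ≤ K * (a ^ (-β) / Real.log a ^ 2) := by
  obtain ⟨K, hK, h⟩ := exists_abs_sum_prime_rpow_neg_sub_le hβ
  refine ⟨K + 1 / β, by positivity, fun a b ha hab hlog ↦ ?_⟩
  have ha0 : 0 < a := by linarith
  have hb0 : 0 < b := by linarith
  have hla : 0 < Real.log a := Real.log_pos (by linarith)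
  have hlab : Real.log a ≤ Real.log b := Real.log_le_log ha0 hab
  have hlb : 0 < Real.log b := hla.trans_le hlab
  have h1 := h a b ha hab
  have h2 : |b ^ (-β) / (β * Real.log b)| ≤ 1 / β * (a ^ (-β) / Real.log a ^ 2) := by
    rw [abs_of_nonneg (by positivity)]
    have h3 : b ^ (-β) ≤ a ^ (-β) / Real.log a := by
      rw [le_div_iff₀ hla]
      calc b ^ (-β) * Real.log a ≤ b ^ (-β) * (b / a) ^ β := by gcongr
        _ = a ^ (-β) := by
          rw [Real.div_rpow hb0.le ha0.le, Real.rpow_neg hb0.le, Real.rpow_neg ha0.le]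
          field_simp
    calc b ^ (-β) / (β * Real.log b) ≤ (a ^ (-β) / Real.log a) / (β * Real.log a) := by gcongr
      _ = _ := by field_simp
  set S := ∑ p ∈ Finset.Ioc ⌊a⌋₊ ⌊b⌋₊ with p.Prime, (p : ℝ) ^ (-1 - β)
  have e : S - a ^ (-β) / (β * Real.log a) =
    (S - (a ^ (-β) / (β * Real.log a) - b ^ (-β) / (β * Real.log b))) -
      b ^ (-β) / (β * Real.log b) := by ring
  rw [e]
  refine (abs_sub _ _).trans ?_
  linarith

lemma abs_one_div_sub_three_div_le {l L m : ℝ} (hL : 0 < L) (hl : L / 6 ≤ l)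
    (hm : |l - L / 3| ≤ 2 * m) : |1 / l - 3 / L| ≤ 36 * (m / L ^ 2) := by
  have hl0 : 0 < l := by linarith
  have e : 1 / l - 3 / L = -(l - L / 3) * (1 / l * (3 / L)) := by field_simp; ring
  have h1 : 1 / l ≤ 1 / (L / 6) := by gcongr
  rw [e, abs_mul, abs_neg, abs_of_pos (by positivity : 0 < 1 / l * (3 / L))]
  calc |l - L / 3| * (1 / l * (3 / L)) ≤ 2 * m * (1 / (L / 6) * (3 / L)) := by
        have : 0 ≤ m := by linarith [abs_nonneg (l - L / 3)]
        gcongr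
    _ = _ := by field_simp; ring

lemma exists_abs_sumPrimeRpow_sub_le_of_log {α : ℝ} (hα : 0 < α) :
    ∃ K > 0, ∀ y L m : ℝ, 2 ≤ y → 0 < L → L / 6 ≤ Real.log y → |Real.log y - L / 3| ≤ 2 * m →
      |sumPrimeRpow α y - 3 / ((α + 1) * L) * y ^ (α + 1)| ≤
        K * (y ^ (α + 1) * ((1 + m) / L ^ 2)) := by
  obtain ⟨K, hK, h⟩ := exists_abs_sumPrimeRpow_sub_le hα
  refine ⟨36 * K + 36 / (α + 1), by positivity, fun y L m hy hL hl hm ↦ ?_⟩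
  have hy0 : 0 < y := by linarith
  have h1 := h y hy
  have h2 := abs_one_div_sub_three_div_le hL hl hm
  have hm0 : 0 ≤ m := by linarith [abs_nonneg (Real.log y - L / 3)]
  have hly : 0 < Real.log y := by linarith
  have e : sumPrimeRpow α y - 3 / ((α + 1) * L) * y ^ (α + 1) =
      (sumPrimeRpow α y - y ^ (α + 1) / ((α + 1) * Real.log y)) +
        y ^ (α + 1) / (α + 1) * (1 / Real.log y - 3 / L) := by field_simp; ring
  have h3 : y ^ (α + 1) / Real.log y ^ 2 ≤ 36 * (y ^ (α + 1) * ((1 + m) / L ^ 2)) := by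
    calc y ^ (α + 1) / Real.log y ^ 2 ≤ y ^ (α + 1) / (L / 6) ^ 2 := by gcongr
      _ = 36 * (y ^ (α + 1) * ((1 + 0) / L ^ 2)) := by field_simp; ring
      _ ≤ _ := by gcongr
  have h4 : |y ^ (α + 1) / (α + 1) * (1 / Real.log y - 3 / L)| ≤
      36 / (α + 1) * (y ^ (α + 1) * ((1 + m) / L ^ 2)) := by
    rw [abs_mul, abs_of_pos (by positivity : 0 < y ^ (α + 1) / (α + 1))]
    calc _ ≤ y ^ (α + 1) / (α + 1) * (36 * ((1 + m) / L ^ 2)) := by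
          gcongr
          refine h2.trans ?_
          gcongr
          linarith
      _ = _ := by ring
  rw [e]
  refine (abs_add_le _ _).trans ((add_le_add h1 h4).trans ?_)
  have h5 := mul_le_mul_of_nonneg_left h3 hK.le
  linarith

lemma exists_abs_sum_range_prime_rpow_neg_sub_le {α : ℝ} (hα : 0 < α) :
    ∃ K > 0, ∀ (p : ℕ) (w L m : ℝ), p.Prime → 2 ≤ w → w < p → 1 ≤ L →
      L / 6 ≤ Real.log w → |Real.log w - L / 3| ≤ 2 * m → |Real.log p - L / 3| ≤ 2 * m →
      |∑ q ∈ (Finset.range p).filter (fun q : ℕ ↦ q.Prime ∧ w < q), (q : ℝ) ^ (-1 - α) -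
        3 / (α * L) * (w ^ (-α) - (p : ℝ) ^ (-α))| ≤ K * (w ^ (-α) * ((1 + m) / L ^ 2)) ∧
      ∑ q ∈ (Finset.range p).filter (fun q : ℕ ↦ q.Prime ∧ w < q), (q : ℝ) ^ (-1 - α) ≤
        K * (w ^ (-α) / L) := by
  obtain ⟨K, hK, h⟩ := exists_abs_sum_prime_rpow_neg_sub_le hα
  refine ⟨36 * K + 144 + 72 / α, by positivity, fun p w L m hp hw hwp hL hlw hmw hmp ↦ ?_⟩
  have hw0 : 0 < w := by linarith
  have hp0 : (0 : ℝ) < p := by linarith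
  have hL0 : 0 < L := by linarith
  have hlw0 : 0 < Real.log w := by linarith
  have hlwp : Real.log w ≤ Real.log p := Real.log_le_log hw0 hwp.le
  have hm0 : 0 ≤ m := by linarith [abs_nonneg (Real.log w - L / 3)]
  have h1 := h w p hw hwp.le
  rw [Nat.floor_natCast] at h1
  set S := ∑ q ∈ (Finset.range p).filter (fun q : ℕ ↦ q.Prime ∧ w < q), (q : ℝ) ^ (-1 - α)
    with hS
  have hsum : ∑ q ∈ Finset.Ioc ⌊w⌋₊ p with q.Prime, (q : ℝ) ^ (-1 - α) =
      (p : ℝ) ^ (-1 - α) + S := by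
    have hset : (Finset.Ioc ⌊w⌋₊ p).filter Nat.Prime =
        insert p ((Finset.range p).filter (fun q : ℕ ↦ q.Prime ∧ w < q)) := by
      ext q
      simp only [Finset.mem_filter, Finset.mem_Ioc, Nat.floor_lt hw0.le, Finset.mem_insert,
        Finset.mem_range]
      constructor
      · rintro ⟨⟨h1, h2⟩, h3⟩
        rcases h2.eq_or_lt with h4 | h4
        · exact Or.inl h4
        · exact Or.inr ⟨h4, h3, h1⟩
      · rintro (rfl | ⟨h1, h2, h3⟩)
        · exact ⟨⟨hwp, le_rfl⟩, hp⟩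
        · exact ⟨⟨h3, h1.le⟩, h2⟩
    rw [hset, Finset.sum_insert (by simp)]
  rw [hsum] at h1
  have hwle : w ^ (-α) / Real.log w ^ 2 ≤ 36 * (w ^ (-α) * (1 / L ^ 2)) := by
    calc w ^ (-α) / Real.log w ^ 2 ≤ w ^ (-α) / (L / 6) ^ 2 := by gcongr
      _ = _ := by field_simp; ring
  have hpw : (p : ℝ) ^ (-α) ≤ w ^ (-α) := Real.rpow_le_rpow_of_nonpos hw0 hwp.le (by linarith)
  have hp1 : (p : ℝ) ^ (-1 - α) ≤ 144 * (w ^ (-α) * (1 / L ^ 2)) := by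
    have h2 : L ^ 2 ≤ 144 * p := by
      have h3 := log_sq_le_four_mul (y := (p : ℝ)) (by linarith)
      have h4 : L ≤ 6 * Real.log p := by linarith
      have h5 := pow_le_pow_left₀ hL0.le h4 2
      nlinarith
    have h3 : (p : ℝ) ^ (-1 - α) = (p : ℝ) ^ (-α) * (1 / p) := by
      rw [sub_eq_add_neg, Real.rpow_add hp0, Real.rpow_neg_one]; ring
    have h4 : 1 / (p : ℝ) ≤ 144 * (1 / L ^ 2) := by
      rw [mul_one_div, div_le_div_iff₀ hp0 (by positivity)]
      linarith
    rw [h3]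
    calc (p : ℝ) ^ (-α) * (1 / p) ≤ w ^ (-α) * (144 * (1 / L ^ 2)) := by gcongr
      _ = _ := by ring
  have hp10 : 0 ≤ (p : ℝ) ^ (-1 - α) := by positivity
  have hlep : L / 6 ≤ Real.log p := hlw.trans hlwp
  have h2 := abs_one_div_sub_three_div_le hL0 hlw hmw
  have h3 := abs_one_div_sub_three_div_le hL0 hlep hmp
  have hK1 := mul_le_mul_of_nonneg_left hwle hK.le
  constructor
  · have e : S - 3 / (α * L) * (w ^ (-α) - (p : ℝ) ^ (-α)) =
        ((p : ℝ) ^ (-1 - α) + S - (w ^ (-α) / (α * Real.log w) -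
          (p : ℝ) ^ (-α) / (α * Real.log p))) - (p : ℝ) ^ (-1 - α) +
        (w ^ (-α) / α * (1 / Real.log w - 3 / L) -
          (p : ℝ) ^ (-α) / α * (1 / Real.log p - 3 / L)) := by
      have : Real.log p ≠ 0 := by linarith
      field_simp
      ring
    have h4 : |w ^ (-α) / α * (1 / Real.log w - 3 / L)| ≤
        w ^ (-α) / α * (36 * (m / L ^ 2)) := by
      rw [abs_mul, abs_of_pos (by positivity : 0 < w ^ (-α) / α)]
      gcongr
    have h5 : |(p : ℝ) ^ (-α) / α * (1 / Real.log p - 3 / L)| ≤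
        w ^ (-α) / α * (36 * (m / L ^ 2)) := by
      rw [abs_mul, abs_of_pos (by positivity : 0 < (p : ℝ) ^ (-α) / α)]
      gcongr
    rw [e]
    refine (abs_add_le _ _).trans ((add_le_add (abs_sub _ _) (abs_sub _ _)).trans ?_)
    rw [abs_of_nonneg hp10]
    have hr1 : w ^ (-α) * ((1 + m) / L ^ 2) = w ^ (-α) * (1 / L ^ 2) + w ^ (-α) * (m / L ^ 2) := by
      ring
    have hr2 : w ^ (-α) / α * (36 * (m / L ^ 2)) = 36 / α * (w ^ (-α) * (m / L ^ 2)) := by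
      ring
    have hA : 0 ≤ w ^ (-α) * (1 / L ^ 2) := by positivity
    have hB : 0 ≤ w ^ (-α) * (m / L ^ 2) := by positivity
    have hA' : 0 ≤ 72 / α * (w ^ (-α) * (1 / L ^ 2)) := by positivity
    have hB' : 0 ≤ K * (w ^ (-α) * (m / L ^ 2)) := by positivity
    rw [hr2] at h4 h5
    rw [hr1]
    have e72 : 72 / α = 2 * (36 / α) := by ring
    rw [e72] at hA' ⊢
    linarith
  · have h4 := (abs_le.1 h1).2
    have h5 : 0 ≤ (p : ℝ) ^ (-α) / (α * Real.log p) := by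
      have : 0 < Real.log p := by linarith
      positivity
    have h6 : w ^ (-α) / (α * Real.log w) ≤ 72 / α * (w ^ (-α) / L) := by
      calc w ^ (-α) / (α * Real.log w) ≤ w ^ (-α) / (α * (L / 6)) := by gcongr
        _ = 6 / α * (w ^ (-α) / L) := by field_simp
        _ ≤ _ := by gcongr; norm_num
    have h7 : w ^ (-α) * (1 / L ^ 2) ≤ w ^ (-α) / L := by
      rw [mul_one_div]
      gcongr
      nlinarith
    have h8 := mul_le_mul_of_nonneg_left h7 (by positivity : 0 ≤ 36 * K)
    have h9 : 0 ≤ w ^ (-α) / L := by positivity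
    linarith

lemma two_le_of_two_le_log {y : ℝ} (hy : 0 < y) (h : 2 ≤ Real.log y) : 2 ≤ y := by
  have := Real.log_le_sub_one_of_pos hy
  linarith

lemma exists_abs_sum_sumPrimeRpow_sub_le {α : ℝ} (hα : 0 < α) :
    ∃ K > 0, ∀ (x : ℝ) (p : ℕ), p.Prime → 12 ≤ Real.log x → Real.log x / 3 < Real.log p →
      Real.log p ≤ Real.log x / 3 + Real.log x / 12 → 0 < x →
      |(p : ℝ) ^ (-α) * ∑ q ∈ (Finset.range p).filter
          (fun q : ℕ ↦ q.Prime ∧ Real.sqrt (x / (p : ℝ)) < (q : ℝ)),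
            sumPrimeRpow α (x / ((q : ℝ) * (p : ℝ))) -
        9 / (α * (α + 1)) / Real.log x ^ 2 * (x ^ (1 + 3 * α / 2 / 3) * (p : ℝ) ^ (-1 - 3 * α / 2) -
          x ^ (1 + 3 * α / 3) * (p : ℝ) ^ (-1 - 3 * α))| ≤
      K / Real.log x ^ 3 * (x ^ (1 + α / 3) * (p : ℝ) ^ (-1 - α)) := by
  obtain ⟨K₁, hK₁, h₁⟩ := exists_abs_sumPrimeRpow_sub_le_of_log hα
  obtain ⟨K₂, hK₂, h₂⟩ := exists_abs_sum_range_prime_rpow_neg_sub_le hα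
  refine ⟨(K₁ * K₂ + 3 / (α + 1) * K₂) * (1 + 2 / α), by positivity,
    fun x p hp hL hlo hhi hx0 ↦ ?_⟩
  set L := Real.log x with hLdef
  set m := Real.log p - L / 3 with hm
  have hm0 : 0 < m := by linarith
  have hmL : m ≤ L / 12 := by linarith
  have hL0 : 0 < L := by linarith
  have hp0 : (0 : ℝ) < p := by exact_mod_cast hp.pos
  set w := √(x / p) with hw
  have hw0 : 0 < w := Real.sqrt_pos.2 (by positivity)
  have hlw : Real.log w = L / 3 - m / 2 := by
    rw [hw, Real.log_sqrt (by positivity), Real.log_div hx0.ne' hp0.ne']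
    linarith
  have hwp : w < p := (Real.log_lt_log_iff hw0 hp0).1 (by linarith)
  have hw2 : 2 ≤ w := two_le_of_two_le_log hw0 (by linarith)
  obtain ⟨h3, h4⟩ := h₂ p w L m hp hw2 hwp (by linarith) (by linarith)
    (by rw [hlw, abs_le]; constructor <;> linarith)
    (by rw [abs_le]; constructor <;> linarith)
  set Q := (Finset.range p).filter (fun q : ℕ ↦ q.Prime ∧ w < (q : ℝ)) with hQ
  set S := ∑ q ∈ Q, (q : ℝ) ^ (-1 - α) with hS
  set P := x ^ (α + 1) * (p : ℝ) ^ (-1 - α) with hP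
  have hP0 : 0 < P := by positivity
  have hinner : |∑ q ∈ Q, sumPrimeRpow α (x / (q * p)) - 3 / ((α + 1) * L) * (P * S)| ≤
      K₁ * ((1 + m) / L ^ 2) * (P * S) := by
    rw [hS, Finset.mul_sum, Finset.mul_sum, Finset.mul_sum, ← Finset.sum_sub_distrib]
    refine (Finset.abs_sum_le_sum_abs _ _).trans (Finset.sum_le_sum fun q hq ↦ ?_)
    rw [hQ, Finset.mem_filter, Finset.mem_range] at hq
    obtain ⟨hqp, hqprime, hwq⟩ := hq
    have hq0 : (0 : ℝ) < q := hw0.trans hwq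
    have hlq : Real.log w ≤ Real.log q := Real.log_le_log hw0 hwq.le
    have hlq' : Real.log q ≤ Real.log p := Real.log_le_log hq0 (by exact_mod_cast hqp.le)
    have hy0 : 0 < x / (q * p) := by positivity
    have hly : Real.log (x / (q * p)) = L - Real.log q - Real.log p := by
      rw [Real.log_div hx0.ne' (by positivity), Real.log_mul hq0.ne' hp0.ne']
      ring
    have hy : (x / (q * p)) ^ (α + 1) = P * (q : ℝ) ^ (-1 - α) := by
      rw [hP, Real.rpow_def_of_pos hy0, hly, Real.rpow_def_of_pos hx0, Real.rpow_def_of_pos hp0,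
        Real.rpow_def_of_pos hq0, ← Real.exp_add, ← Real.exp_add]
      congr 1
      ring
    have h5 := h₁ (x / (q * p)) L m (two_le_of_two_le_log hy0 (by linarith)) hL0 (by linarith)
      (by rw [hly, abs_le]; constructor <;> linarith)
    rw [hy] at h5
    refine h5.trans (le_of_eq ?_)
    ring
  have hmain : |3 / ((α + 1) * L) * (P * S) -
      3 / ((α + 1) * L) * (P * (3 / (α * L) * (w ^ (-α) - (p : ℝ) ^ (-α))))| ≤
      3 / ((α + 1) * L) * (P * (K₂ * (w ^ (-α) * ((1 + m) / L ^ 2)))) := by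
    rw [← mul_sub, ← mul_sub, abs_mul, abs_mul, abs_of_pos hP0,
      abs_of_pos (by positivity : 0 < 3 / ((α + 1) * L))]
    gcongr
  have hbound : |∑ q ∈ Q, sumPrimeRpow α (x / (q * p)) -
      3 / ((α + 1) * L) * (P * (3 / (α * L) * (w ^ (-α) - (p : ℝ) ^ (-α))))| ≤
      (K₁ * K₂ + 3 / (α + 1) * K₂) / L ^ 3 * (1 + m) * (P * w ^ (-α)) := by
    refine (abs_sub_le _ (3 / ((α + 1) * L) * (P * S)) _).trans ((add_le_add hinner hmain).trans ?_)
    calc K₁ * ((1 + m) / L ^ 2) * (P * S) +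
          3 / ((α + 1) * L) * (P * (K₂ * (w ^ (-α) * ((1 + m) / L ^ 2))))
        ≤ K₁ * ((1 + m) / L ^ 2) * (P * (K₂ * (w ^ (-α) / L))) +
          3 / ((α + 1) * L) * (P * (K₂ * (w ^ (-α) * ((1 + m) / L ^ 2)))) := by gcongr
      _ = _ := by field_simp
  have hlp : Real.log p = L / 3 + m := by rw [hm]; ring
  have e1 : (p : ℝ) ^ (-α) * (P * w ^ (-α)) =
      x ^ (1 + 3 * α / 2 / 3) * (p : ℝ) ^ (-1 - 3 * α / 2) := by
    rw [hP, Real.rpow_def_of_pos hx0, Real.rpow_def_of_pos hx0, Real.rpow_def_of_pos hp0,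
      Real.rpow_def_of_pos hp0, Real.rpow_def_of_pos hp0, Real.rpow_def_of_pos hw0,
      ← Real.exp_add, ← Real.exp_add, ← Real.exp_add, ← Real.exp_add, hlw, hlp, ← hLdef]
    congr 1
    ring
  have e2 : (p : ℝ) ^ (-α) * (P * (p : ℝ) ^ (-α)) =
      x ^ (1 + 3 * α / 3) * (p : ℝ) ^ (-1 - 3 * α) := by
    rw [hP, Real.rpow_def_of_pos hx0, Real.rpow_def_of_pos hx0, Real.rpow_def_of_pos hp0,
      Real.rpow_def_of_pos hp0, Real.rpow_def_of_pos hp0,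
      ← Real.exp_add, ← Real.exp_add, ← Real.exp_add, ← Real.exp_add, hlp, ← hLdef]
    congr 1
    ring
  have e3 : x ^ (1 + 3 * α / 2 / 3) * (p : ℝ) ^ (-1 - 3 * α / 2) * Real.exp (α * m / 2) =
      x ^ (1 + α / 3) * (p : ℝ) ^ (-1 - α) := by
    rw [Real.rpow_def_of_pos hx0, Real.rpow_def_of_pos hx0, Real.rpow_def_of_pos hp0,
      Real.rpow_def_of_pos hp0, ← Real.exp_add, ← Real.exp_add, ← Real.exp_add, hlp, ← hLdef]
    congr 1
    ring
  have e4 : (p : ℝ) ^ (-α) * ∑ q ∈ Q, sumPrimeRpow α (x / (q * p)) -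
      9 / (α * (α + 1)) / L ^ 2 * (x ^ (1 + 3 * α / 2 / 3) * (p : ℝ) ^ (-1 - 3 * α / 2) -
          x ^ (1 + 3 * α / 3) * (p : ℝ) ^ (-1 - 3 * α)) =
      (p : ℝ) ^ (-α) * (∑ q ∈ Q, sumPrimeRpow α (x / (q * p)) -
      3 / ((α + 1) * L) * (P * (3 / (α * L) * (w ^ (-α) - (p : ℝ) ^ (-α))))) := by
    rw [← e1, ← e2]
    generalize ∑ q ∈ Q, sumPrimeRpow α (x / (q * p)) = Z
    field_simp
    ring
  have hm1 : 1 + m ≤ (1 + 2 / α) * Real.exp (α * m / 2) := by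
    have h5 := Real.add_one_le_exp (α * m / 2)
    have h6 : 0 < α * m / 2 := by positivity
    have h7 : m = 2 / α * (α * m / 2) := by field_simp
    calc 1 + m = 1 + 2 / α * (α * m / 2) := by rw [← h7]
      _ ≤ Real.exp (α * m / 2) + 2 / α * Real.exp (α * m / 2) := by
          gcongr <;> linarith
      _ = _ := by ring
  rw [e4, abs_mul, abs_of_pos (by positivity : 0 < (p : ℝ) ^ (-α))]
  calc (p : ℝ) ^ (-α) * |_|
      ≤ (p : ℝ) ^ (-α) * ((K₁ * K₂ + 3 / (α + 1) * K₂) / L ^ 3 * (1 + m) * (P * w ^ (-α))) := by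
        gcongr
    _ = (K₁ * K₂ + 3 / (α + 1) * K₂) / L ^ 3 * (1 + m) *
          (x ^ (1 + 3 * α / 2 / 3) * (p : ℝ) ^ (-1 - 3 * α / 2)) := by rw [← e1]; ring
    _ ≤ (K₁ * K₂ + 3 / (α + 1) * K₂) / L ^ 3 * ((1 + 2 / α) * Real.exp (α * m / 2)) *
          (x ^ (1 + 3 * α / 2 / 3) * (p : ℝ) ^ (-1 - 3 * α / 2)) := by gcongr
    _ = _ := by rw [← e3]; ring

lemma exists_abs_rpow_mul_sum_sub_le {β : ℝ} (hβ : 0 < β) :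
    ∃ K > 0, ∀ x V : ℝ, 0 < x → 12 ≤ Real.log x → 1 ≤ V → Real.log x ≤ V ^ β →
      |∑ p ∈ Finset.Ioc ⌊x ^ ((1 : ℝ) / 3)⌋₊ ⌊x ^ ((1 : ℝ) / 3) * V⌋₊ with p.Prime,
          x ^ (1 + β / 3) * (p : ℝ) ^ (-1 - β) - 3 / β * (x / Real.log x)| ≤
        K * (x / Real.log x ^ 2) := by
  obtain ⟨K, hK, h⟩ := exists_abs_sum_prime_rpow_neg_sub_le_of_long hβ
  refine ⟨9 * K, by positivity, fun x V hx hL hV hLV ↦ ?_⟩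
  have hL0 : 0 < Real.log x := by linarith
  set X := x ^ ((1 : ℝ) / 3) with hX
  have hX0 : 0 < X := by positivity
  have hlX : Real.log X = Real.log x / 3 := by rw [hX, Real.log_rpow hx]; ring
  have hX2 : 2 ≤ X := two_le_of_two_le_log hX0 (by linarith)
  have h1 := h X (X * V) hX2 (le_mul_of_one_le_right hX0.le hV)
    (by rw [mul_div_cancel_left₀ _ hX0.ne']; linarith)
  rw [← Finset.mul_sum]
  set S := ∑ p ∈ Finset.Ioc ⌊X⌋₊ ⌊X * V⌋₊ with p.Prime, (p : ℝ) ^ (-1 - β)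
  have e1 : x ^ (1 + β / 3) * X ^ (-β) = x := by
    rw [hX, ← Real.rpow_mul hx.le, ← Real.rpow_add hx]
    convert Real.rpow_one x using 2
    ring
  have e2 : x ^ (1 + β / 3) * S - 3 / β * (x / Real.log x) =
      x ^ (1 + β / 3) * (S - X ^ (-β) / (β * Real.log X)) := by
    have : x ^ (1 + β / 3) * (X ^ (-β) / (β * Real.log X)) = 3 / β * (x / Real.log x) := by
      rw [hlX, mul_div_assoc', e1]
      field_simp
    rw [mul_sub, this]
  rw [e2, abs_mul, abs_of_pos (by positivity : 0 < x ^ (1 + β / 3))]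
  calc _ ≤ x ^ (1 + β / 3) * (K * (X ^ (-β) / Real.log X ^ 2)) := by gcongr
    _ = K * ((x ^ (1 + β / 3) * X ^ (-β)) / Real.log X ^ 2) := by ring
    _ = _ := by rw [e1, hlX]; field_simp; ring

end

open Filter Finset

/-- For `α > 0`,
`Σ_{x^{1/3} < p₃ ≤ x^{1/3}(log x)^{4/α}} p₃^{-α} Σ_{√(x/p₃) < p₂ < p₃} Σ_{p₁ ≤ x/(p₂p₃)} p₁^α
  = (9/(α²(α+1)))·x/log³x + O(x/log⁴x)`, the sums ranging over primes. -/
theorem I5_asymptotic (α : ℝ) (hα : 0 < α) :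
    (fun x : ℝ =>
        (∑ p3 ∈ (Finset.Icc 2 ⌊x ^ ((1:ℝ) / 3) * Real.log x ^ ((4:ℝ) / α)⌋₊).filter
            (fun p3 : ℕ => p3.Prime ∧ x ^ ((1:ℝ) / 3) < (p3 : ℝ)),
            (p3 : ℝ) ^ (-α) *
              ∑ p2 ∈ (Finset.range p3).filter
                  (fun p2 : ℕ => p2.Prime ∧ Real.sqrt (x / (p3 : ℝ)) < (p2 : ℝ)),
                ∑ p1 ∈ (Finset.Icc 2 ⌊x / ((p2 : ℝ) * (p3 : ℝ))⌋₊).filter Nat.Prime,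
                  (p1 : ℝ) ^ α)
        - (9 / (α ^ 2 * (α + 1))) * (x / Real.log x ^ 3))
      =O[atTop] (fun x : ℝ => x / Real.log x ^ 4) := by
  obtain ⟨K, hK, hD⟩ := exists_abs_sum_sumPrimeRpow_sub_le hα
  obtain ⟨K₁, hK₁, h₁⟩ := exists_abs_rpow_mul_sum_sub_le (β := 3 * α / 2) (by positivity)
  obtain ⟨K₂, hK₂, h₂⟩ := exists_abs_rpow_mul_sum_sub_le (β := 3 * α) (by positivity)
  obtain ⟨K₃, hK₃, h₃⟩ := exists_abs_rpow_mul_sum_sub_le hα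
  refine Asymptotics.IsBigO.of_bound
    (K * (3 / α + K₃) + 9 / (α * (α + 1)) * (K₁ + K₂)) ?_
  have hloglog : ∀ᶠ x : ℝ in atTop, 4 / α * Real.log (Real.log x) ≤ Real.log x / 12 := by
    have h := (Real.isLittleO_log_id_atTop.comp_tendsto Real.tendsto_log_atTop).bound
      (by positivity : 0 < α / 48)
    filter_upwards [h, Real.tendsto_log_atTop.eventually_ge_atTop 1] with x hx hx1
    simp only [Function.comp_apply, id, Real.norm_eq_abs] at hx
    rw [abs_of_nonneg (Real.log_nonneg hx1), abs_of_nonneg (by linarith)] at hx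
    rw [div_mul_eq_mul_div, div_le_div_iff₀ hα (by norm_num)]
    linarith
  filter_upwards [hloglog, Real.tendsto_log_atTop.eventually_ge_atTop 12,
    eventually_gt_atTop 0] with x hll hL hx0
  set L := Real.log x with hLdef
  have hL0 : 0 < L := by linarith
  set X := x ^ ((1 : ℝ) / 3) with hX
  set V := L ^ (4 / α) with hV
  have hX0 : 0 < X := by positivity
  have hV0 : 0 < V := by positivity
  have hlX : Real.log X = L / 3 := by rw [hX, Real.log_rpow hx0]; ring
  have hV1 : 1 ≤ V := Real.one_le_rpow (by linarith) (by positivity)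
  have hVL (β : ℝ) (hβ : α ≤ β) : L ≤ V ^ β := by
    rw [hV, ← Real.rpow_mul hL0.le]
    refine Real.self_le_rpow_of_one_le (by linarith) ?_
    rw [div_mul_eq_mul_div, one_le_div hα]
    linarith
  have hX2 : 2 ≤ X := two_le_of_two_le_log hX0 (by linarith)
  have hset : (Finset.Icc 2 ⌊X * V⌋₊).filter (fun p : ℕ => p.Prime ∧ X < (p : ℝ)) =
      (Finset.Ioc ⌊X⌋₊ ⌊X * V⌋₊).filter Nat.Prime := by
    ext p
    simp only [Finset.mem_filter, Finset.mem_Icc, Finset.mem_Ioc, Nat.floor_lt hX0.le]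
    constructor
    · rintro ⟨⟨h1, h2⟩, h3, h4⟩
      exact ⟨⟨h4, h2⟩, h3⟩
    · rintro ⟨⟨h4, h2⟩, h3⟩
      exact ⟨⟨h3.two_le, h2⟩, h3, h4⟩
  rw [hset]
  set I := (Finset.Ioc ⌊X⌋₊ ⌊X * V⌋₊).filter Nat.Prime with hI
  have hterm := Finset.sum_le_sum fun p (hp : p ∈ I) ↦ hD x p (Finset.mem_filter.1 hp).2 hL
    (by
      rw [hI, Finset.mem_filter, Finset.mem_Ioc, Nat.floor_lt hX0.le] at hp
      rw [← hlX]
      exact Real.log_lt_log hX0 hp.1.1)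
    (by
      rw [hI, Finset.mem_filter, Finset.mem_Ioc, Nat.le_floor_iff (by positivity)] at hp
      have hp0 : (0 : ℝ) < p := by exact_mod_cast hp.2.pos
      refine (Real.log_le_log hp0 hp.1.2).trans ?_
      rw [Real.log_mul hX0.ne' hV0.ne', hlX, hV, Real.log_rpow hL0]
      linarith) hx0
  replace hterm := (Finset.abs_sum_le_sum_abs _ _).trans hterm
  rw [Finset.sum_sub_distrib, ← Finset.mul_sum, ← Finset.mul_sum, Finset.sum_sub_distrib] at hterm
  have h₁' := h₁ x V hx0 hL hV1 (hVL _ (by linarith))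
  have h₂' := h₂ x V hx0 hL hV1 (hVL _ (by linarith))
  have h₃' := h₃ x V hx0 hL hV1 (hVL _ le_rfl)
  set S₁ := ∑ p ∈ I, x ^ (1 + 3 * α / 2 / 3) * (p : ℝ) ^ (-1 - 3 * α / 2)
  set S₂ := ∑ p ∈ I, x ^ (1 + 3 * α / 3) * (p : ℝ) ^ (-1 - 3 * α)
  set S₃ := ∑ p ∈ I, x ^ (1 + α / 3) * (p : ℝ) ^ (-1 - α)
  change ‖(∑ p ∈ I, (p : ℝ) ^ (-α) * ∑ q ∈ (Finset.range p).filter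
    (fun q : ℕ ↦ q.Prime ∧ Real.sqrt (x / (p : ℝ)) < (q : ℝ)),
      sumPrimeRpow α (x / ((q : ℝ) * (p : ℝ)))) - _‖ ≤ _
  set Z := ∑ p ∈ I, (p : ℝ) ^ (-α) * ∑ q ∈ (Finset.range p).filter
    (fun q : ℕ ↦ q.Prime ∧ Real.sqrt (x / (p : ℝ)) < (q : ℝ)),
      sumPrimeRpow α (x / ((q : ℝ) * (p : ℝ)))
  have hx4 : 0 < x / L ^ 4 := by positivity
  have hS₃ : S₃ ≤ (3 / α + K₃) * (x / L) := by
    have h1 := (abs_le.1 h₃').2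
    have h2 : x / L ^ 2 ≤ x / L := by
      gcongr
      nlinarith
    have h3 := mul_le_mul_of_nonneg_left h2 hK₃.le
    linarith
  have hmain : |9 / (α * (α + 1)) / L ^ 2 * (S₁ - S₂) - 9 / (α ^ 2 * (α + 1)) * (x / L ^ 3)| ≤
      9 / (α * (α + 1)) / L ^ 2 * ((K₁ + K₂) * (x / L ^ 2)) := by
    have e : 9 / (α * (α + 1)) / L ^ 2 * (S₁ - S₂) - 9 / (α ^ 2 * (α + 1)) * (x / L ^ 3) =
        9 / (α * (α + 1)) / L ^ 2 * ((S₁ - 3 / (3 * α / 2) * (x / L)) -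
          (S₂ - 3 / (3 * α) * (x / L))) := by
      field_simp
      ring
    rw [e, abs_mul, abs_of_pos (by positivity : 0 < 9 / (α * (α + 1)) / L ^ 2)]
    gcongr
    refine (abs_sub _ _).trans ?_
    linarith
  rw [Real.norm_eq_abs, Real.norm_eq_abs, abs_of_pos hx4]
  refine (abs_sub_le _ (9 / (α * (α + 1)) / L ^ 2 * (S₁ - S₂)) _).trans
    ((add_le_add hterm hmain).trans ?_)
  calc K / L ^ 3 * S₃ + 9 / (α * (α + 1)) / L ^ 2 * ((K₁ + K₂) * (x / L ^ 2))
      ≤ K / L ^ 3 * ((3 / α + K₃) * (x / L)) +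
        9 / (α * (α + 1)) / L ^ 2 * ((K₁ + K₂) * (x / L ^ 2)) := by gcongr
    _ = _ := by field_simp
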